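/- arXiv:math-ph/0112025 — 2 statements merged into one kernel-verified Lean document; each statement's English description precedes it below -/
import Mathlib

section
/- Fix an integer N ≥ 2, a positive integer m, set ℓ = (N−1)m, and let ℏ be a nonzero complex number. Then there exists a unique family {H_{ε₁,…,ε_ℓ}(α₁,…,α_ℓ)} of rational functions in ℓ variables over ℂ, indexed by the tuples ε = (ε₁,…,ε_ℓ) with entries in {0,…,N−2} satisfying #{a : ε_a ≥ j} = (N−1−j)m for j = 1,…,N−2, such that: (i) for every p with 1 ≤ p ≤ ℓ−1, H_{…,ε_{p+1},ε_p,…}(…,α_{p+1},α_p,…) = [(α_p−α_{p+1})/(α_p−α_{p+1}+ℏ)]·H_{…,ε_p,ε_{p+1},…}(…,α_p,α_{p+1},…) + [ℏ/(α_p−α_{p+1}+ℏ)]·H_{…,ε_{p+1},ε_p,…}(…,α_p,α_{p+1},…), where only the p-th and (p+1)-st indices and arguments are displayed; (ii) H_{ε₁,…,ε_ℓ}(α₁,…,α_{ℓ−1},α_ℓ−Nℏ) = ∏_{a=1}^{ℓ−1} [(α_a−α_ℓ+ℏ)/(α_a−α_ℓ+(N−1)ℏ)]·H_{ε_ℓ,ε₁,…,ε_{ℓ−1}}(α_ℓ,α₁,…,α_{ℓ−1});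 (iii) for the increasing tuple ε = (0,…,0,1,…,1,…,N−2,…,N−2) (each value repeated m times), H_ε(α₁,…,α_ℓ) = ∏_{(a,b): ε_a<ε_b} 1/(α_a−α_b−ℏ), the product over all ordered pairs (a,b) with ε_a < ε_b. -/
open MvPolynomial Finset

noncomputable section

/-- The field `ℂ(α₁,…,α_ℓ)` of rational functions in `ℓ` variables, realized as the
fraction field of the polynomial ring `ℂ[α₁,…,α_ℓ]`. -/
abbrev RF (ℓ : ℕ) : Type := FractionRing (MvPolynomial (Fin ℓ) ℂ)

/-- Lift an injective substitution of the polynomial ring to the field of rational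
functions. -/
noncomputable def liftRF {ℓ ℓ' : ℕ} (f : MvPolynomial (Fin ℓ) ℂ →+* MvPolynomial (Fin ℓ') ℂ)
    (hf : Function.Injective f) : RF ℓ →+* RF ℓ' :=
  IsFractionRing.lift
    (g := (algebraMap (MvPolynomial (Fin ℓ') ℂ) (RF ℓ')).comp f)
    (fun _ _ hab => hf (IsFractionRing.injective (MvPolynomial (Fin ℓ') ℂ) (RF ℓ') hab))

/-- The action of a permutation `σ` of the variables on rational functions:
`(permRF σ F)(α₁,…,α_ℓ) = F(α_{σ(1)},…,α_{σ(ℓ)})`. -/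
noncomputable def permRF {ℓ : ℕ} (σ : Equiv.Perm (Fin ℓ)) : RF ℓ →+* RF ℓ :=
  liftRF (MvPolynomial.renameEquiv ℂ σ).toAlgHom.toRingHom (MvPolynomial.renameEquiv ℂ σ).injective

/-- The substitution `α_t ↦ α_t + c` as an algebra automorphism of `ℂ[α₁,…,α_ℓ]`. -/
noncomputable def shiftAlgEquiv {ℓ : ℕ} (t : Fin ℓ) (c : ℂ) :
    MvPolynomial (Fin ℓ) ℂ ≃ₐ[ℂ] MvPolynomial (Fin ℓ) ℂ :=
  AlgEquiv.ofAlgHom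
    (aeval fun i => if i = t then X i + C c else X i)
    (aeval fun i => if i = t then X i - C c else X i)
    (by
      apply MvPolynomial.algHom_ext; intro i
      by_cases h : i = t <;> simp [h])
    (by
      apply MvPolynomial.algHom_ext; intro i
      by_cases h : i = t <;> simp [h])

/-- The substitution `α_t ↦ α_t + c` acting on rational functions. -/
noncomputable def shiftRF {ℓ : ℕ} (t : Fin ℓ) (c : ℂ) : RF ℓ →+* RF ℓ :=
  liftRF (shiftAlgEquiv t c).toAlgHom.toRingHom (shiftAlgEquiv t c).injective

/-- The coordinate function `α_a` as a rational function. -/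
noncomputable def XX {ℓ : ℕ} (a : Fin ℓ) : RF ℓ :=
  algebraMap (MvPolynomial (Fin ℓ) ℂ) (RF ℓ) (X a)

/-- A constant as a rational function. -/
noncomputable def CC {ℓ : ℕ} (z : ℂ) : RF ℓ :=
  algebraMap (MvPolynomial (Fin ℓ) ℂ) (RF ℓ) (C z)

/-- `ε = (ε₁,…,ε_ℓ)` is an admissible index tuple: its entries lie in `{0,…,N−2}` and
`#{a : ε_a ≥ j} = (N−1−j)·m` for `j = 1,…,N−2`. -/
def IsIdx (N m ℓ : ℕ) (ε : Fin ℓ → ℕ) : Prop :=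
  (∀ a, ε a ≤ N - 2) ∧
    ∀ j, 1 ≤ j → j ≤ N - 2 →
      (Finset.univ.filter fun a => j ≤ ε a).card = (N - 1 - j) * m

/-- The type of admissible index tuples. -/
abbrev IdxT (N m ℓ : ℕ) := {ε : Fin ℓ → ℕ // IsIdx N m ℓ ε}

/-- Relation (i) = (rel1), the exchange relation:
`H_{…,ε_{p+1},ε_p,…}(…,α_{p+1},α_p,…) = (α_p−α_{p+1})/(α_p−α_{p+1}+ℏ)·H_{…,ε_p,ε_{p+1},…}(…,α_p,α_{p+1},…) + ℏ/(α_p−α_{p+1}+ℏ)·H_{…,ε_{p+1},ε_p,…}(…,α_p,α_{p+1},…)`.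
Here `ε'` is `ε` with its `p`-th and `(p+1)`-st entries interchanged, and applying
`permRF (swap p q)` interchanges the `p`-th and `(p+1)`-st arguments. -/
def HRel1 (N m ℓ : ℕ) (ℏ : ℂ) (H : IdxT N m ℓ → RF ℓ) : Prop :=
  ∀ (ε ε' : IdxT N m ℓ) (p q : Fin ℓ),
    (q : ℕ) = (p : ℕ) + 1 → ε'.1 = ε.1 ∘ Equiv.swap p q →
    permRF (Equiv.swap p q) (H ε') =
      (XX p - XX q) / (XX p - XX q + CC ℏ) * H ε + CC ℏ / (XX p - XX q + CC ℏ) * H ε'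

/-- Relation (ii) = (rel2), the shift relation:
`H_{ε₁,…,ε_ℓ}(α₁,…,α_{ℓ−1},α_ℓ−Nℏ) = ∏_{a=1}^{ℓ−1}(α_a−α_ℓ+ℏ)/(α_a−α_ℓ+(N−1)ℏ) · H_{ε_ℓ,ε₁,…,ε_{ℓ−1}}(α_ℓ,α₁,…,α_{ℓ−1})`.
Here `t` is the last index, `ε' = ε ∘ (finRotate ℓ).symm = (ε_ℓ,ε₁,…,ε_{ℓ−1})`, and
`permRF (finRotate ℓ).symm` cyclically permutes the arguments to `(α_ℓ,α₁,…,α_{ℓ−1})`. -/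
def HRel2 (N m ℓ : ℕ) (ℏ : ℂ) (H : IdxT N m ℓ → RF ℓ) : Prop :=
  ∀ (ε ε' : IdxT N m ℓ) (t : Fin ℓ), (t : ℕ) = ℓ - 1 →
    ε'.1 = ε.1 ∘ (finRotate ℓ).symm →
    shiftRF t (-((N : ℂ) * ℏ)) (H ε) =
      (∏ a ∈ Finset.univ.erase t,
        ((XX a - XX t + CC ℏ) / (XX a - XX t + CC (((N : ℂ) - 1) * ℏ)))) *
        permRF (finRotate ℓ).symm (H ε')

/-- Relation (iii) = (rel3), the normalization: for the increasing index tuple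
`ε = (0^m,1^m,…,(N−2)^m)` (i.e. `ε_a = ⌊a/m⌋`),
`H_ε = ∏_{(a,b) : ε_a<ε_b} 1/(α_a−α_b−ℏ)`, the product over all ordered pairs `(a,b)`
with `ε_a < ε_b`. -/
def HRel3 (N m ℓ : ℕ) (ℏ : ℂ) (H : IdxT N m ℓ → RF ℓ) : Prop :=
  ∀ ε : IdxT N m ℓ, ε.1 = (fun a : Fin ℓ => (a : ℕ) / m) →
    H ε = ∏ ab ∈ Finset.univ.filter
        (fun ab : Fin ℓ × Fin ℓ => (ab.1 : ℕ) / m < (ab.2 : ℕ) / m),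
      (XX ab.1 - XX ab.2 - CC ℏ)⁻¹

section Substitutions

variable {ℓ : ℕ}

lemma liftRF_algebraMap {ℓ' : ℕ} (f : MvPolynomial (Fin ℓ) ℂ →+* MvPolynomial (Fin ℓ') ℂ)
    (hf : Function.Injective f) (P : MvPolynomial (Fin ℓ) ℂ) :
    liftRF f hf (algebraMap _ (RF ℓ) P) = algebraMap _ (RF ℓ') (f P) := by
  exact IsFractionRing.lift_algebraMap _ P

@[simp] lemma permRF_XX (σ : Equiv.Perm (Fin ℓ)) (a : Fin ℓ) : permRF σ (XX a) = XX (σ a) := by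
  refine (liftRF_algebraMap _ _ _).trans ?_
  simp [XX]

@[simp] lemma permRF_CC (σ : Equiv.Perm (Fin ℓ)) (z : ℂ) : permRF σ (CC z) = CC z := by
  refine (liftRF_algebraMap _ _ _).trans ?_
  simp [CC]

@[simp] lemma shiftRF_XX (t a : Fin ℓ) (c : ℂ) :
    shiftRF t c (XX a) = if a = t then XX a + CC c else XX a := by
  refine (liftRF_algebraMap _ _ _).trans ?_
  by_cases h : a = t <;> simp [shiftAlgEquiv, XX, CC, h]

@[simp] lemma shiftRF_CC (t : Fin ℓ) (c z : ℂ) : shiftRF t c (CC z) = CC z := by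
  refine (liftRF_algebraMap _ _ _).trans ?_
  refine congrArg (algebraMap _ (RF ℓ)) ?_
  exact (shiftAlgEquiv t c).toAlgHom.commutes z

lemma ringHom_ext_RF {K : Type*} [Field K] {f g : RF ℓ →+* K}
    (hC : ∀ z, f (CC z) = g (CC z)) (hX : ∀ a, f (XX a) = g (XX a)) : f = g := by
  apply IsLocalization.ringHom_ext (nonZeroDivisors (MvPolynomial (Fin ℓ) ℂ))
  apply MvPolynomial.ringHom_ext
  · exact hC
  · exact hX

lemma permRF_permRF (σ τ : Equiv.Perm (Fin ℓ)) (f : RF ℓ) :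
    permRF σ (permRF τ f) = permRF (σ * τ) f := by
  have : (permRF σ).comp (permRF τ) = permRF (σ * τ) :=
    ringHom_ext_RF (by simp) (by simp)
  exact DFunLike.congr_fun this f

lemma permRF_one (f : RF ℓ) : permRF 1 f = f := by
  have : permRF (1 : Equiv.Perm (Fin ℓ)) = RingHom.id _ :=
    ringHom_ext_RF (by simp) (by simp)
  exact DFunLike.congr_fun this f

lemma permRF_shiftRF (σ : Equiv.Perm (Fin ℓ)) (t : Fin ℓ) (c : ℂ) (f : RF ℓ) :
    permRF σ (shiftRF t c f) = shiftRF (σ t) c (permRF σ f) := by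
  have : (permRF σ).comp (shiftRF t c) = (shiftRF (σ t) c).comp (permRF σ) := by
    refine ringHom_ext_RF (by simp) fun a => ?_
    by_cases h : a = t <;> simp [h]
  exact DFunLike.congr_fun this f

/-- Constants as a ring homomorphism into rational functions. -/
noncomputable def ccHom (ℓ : ℕ) : ℂ →+* RF ℓ :=
  (algebraMap (MvPolynomial (Fin ℓ) ℂ) (RF ℓ)).comp C

lemma CC_eq_ccHom (z : ℂ) : (CC z : RF ℓ) = ccHom ℓ z := rfl

lemma CC_natCast_mul (n : ℕ) (z : ℂ) : (CC ((n : ℂ) * z) : RF ℓ) = (n : RF ℓ) * CC z := by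
  simp [CC_eq_ccHom]

lemma CC_neg (z : ℂ) : (CC (-z) : RF ℓ) = -CC z := by
  simp [CC_eq_ccHom]

lemma CC_ne_zero {z : ℂ} (hz : z ≠ 0) : (CC z : RF ℓ) ≠ 0 := by
  rw [CC_eq_ccHom]
  exact (map_ne_zero _).2 hz

lemma XX_sub_XX_add_CC_ne_zero {a b : Fin ℓ} (hab : a ≠ b) (z : ℂ) :
    (XX a - XX b + CC z : RF ℓ) ≠ 0 := by
  intro h
  have h1 : algebraMap (MvPolynomial (Fin ℓ) ℂ) (RF ℓ) (X a - X b + C z) = 0 := by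
    simpa [XX, CC] using h
  rw [map_eq_zero_iff _ (IsFractionRing.injective (MvPolynomial (Fin ℓ) ℂ) (RF ℓ))] at h1
  have h2 := congrArg (MvPolynomial.eval (fun i => if i = a then 1 - z else 0)) h1
  simp [hab.symm] at h2

lemma XX_sub_XX_ne_zero {a b : Fin ℓ} (hab : a ≠ b) : (XX a - XX b : RF ℓ) ≠ 0 := by
  have := XX_sub_XX_add_CC_ne_zero hab 0
  simpa [CC_eq_ccHom] using this

lemma XX_sub_XX_add_CC_ne_zero' {z : ℂ} (hz : z ≠ 0) (a b : Fin ℓ) :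
    (XX a - XX b + CC z : RF ℓ) ≠ 0 := by
  by_cases h : a = b
  · simpa [h] using CC_ne_zero hz
  · exact XX_sub_XX_add_CC_ne_zero h z

lemma XX_sub_XX_sub_CC_ne_zero {z : ℂ} (hz : z ≠ 0) (a b : Fin ℓ) :
    (XX a - XX b - CC z : RF ℓ) ≠ 0 := by
  have := XX_sub_XX_add_CC_ne_zero' (neg_ne_zero.2 hz) a b
  rwa [CC_neg, ← sub_eq_add_neg] at this

end Substitutions

section Exchange

variable {ℓ : ℕ}

lemma swap_braid {ι : Type*} [DecidableEq ι] {p q r : ι} (hpq : p ≠ q) (hpr : p ≠ r)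
    (hqr : q ≠ r) :
    Equiv.swap q r * (Equiv.swap p q * Equiv.swap q r) =
      Equiv.swap p q * (Equiv.swap q r * Equiv.swap p q) := by
  rw [← mul_assoc, ← mul_assoc, Equiv.swap_comm p q, Equiv.swap_comm q r,
    Equiv.swap_mul_swap_mul_swap hqr.symm hpr.symm, Equiv.swap_comm q p, Equiv.swap_comm r q,
    Equiv.swap_mul_swap_mul_swap hpq hpr, Equiv.swap_comm]

lemma swap_mul_swap_comm {ι : Type*} [DecidableEq ι] {p q r s : ι} (hpr : p ≠ r) (hps : p ≠ s)
    (hqr : q ≠ r) (hqs : q ≠ s) :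
    Equiv.swap p q * Equiv.swap r s = Equiv.swap r s * Equiv.swap p q := by
  rw [Equiv.mul_swap_eq_swap_mul, Equiv.swap_apply_of_ne_of_ne hpr.symm hqr.symm,
    Equiv.swap_apply_of_ne_of_ne hps.symm hqs.symm]

/-- The exchange operator
`f ↦ ((α_p − α_q + ℏ) · f(…,α_q,…,α_p,…) − ℏ · f) / (α_p − α_q)`. -/
noncomputable def exch (ℏ : ℂ) (p q : Fin ℓ) (f : RF ℓ) : RF ℓ :=
  ((XX p - XX q + CC ℏ) * permRF (Equiv.swap p q) f - CC ℏ * f) / (XX p - XX q)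

lemma permRF_swap_swap (p q : Fin ℓ) (f : RF ℓ) :
    permRF (Equiv.swap p q) (permRF (Equiv.swap p q) f) = f := by
  rw [permRF_permRF, Equiv.swap_mul_self, permRF_one]

lemma exch_exch (ℏ : ℂ) {p q : Fin ℓ} (hpq : p ≠ q) (f : RF ℓ) :
    exch ℏ p q (exch ℏ p q f) = f := by
  have h1 := XX_sub_XX_ne_zero hpq
  have h2 := XX_sub_XX_ne_zero hpq.symm
  unfold exch
  simp only [map_sub, map_add, map_mul, map_div₀, permRF_XX, permRF_CC, permRF_swap_swap,
    Equiv.swap_apply_left, Equiv.swap_apply_right]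
  field_simp
  ring

lemma exch_mul (ℏ : ℂ) (p q : Fin ℓ) {g : RF ℓ} (hg : permRF (Equiv.swap p q) g = g)
    (f : RF ℓ) : exch ℏ p q (g * f) = g * exch ℏ p q f := by
  unfold exch
  rw [map_mul, hg]
  ring

lemma exch_eq_self (ℏ : ℂ) {p q : Fin ℓ} (hpq : p ≠ q) {f : RF ℓ}
    (hf : permRF (Equiv.swap p q) f = f) : exch ℏ p q f = f := by
  have h1 := XX_sub_XX_ne_zero hpq
  unfold exch
  rw [hf]
  field_simp
  ring

lemma permRF_exch (ℏ : ℂ) (σ : Equiv.Perm (Fin ℓ)) (p q : Fin ℓ) (f : RF ℓ) :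
    permRF σ (exch ℏ p q f) = exch ℏ (σ p) (σ q) (permRF σ f) := by
  have : σ * Equiv.swap p q = Equiv.swap (σ p) (σ q) * σ := by
    rw [Equiv.mul_swap_eq_swap_mul]
  unfold exch
  simp only [map_sub, map_add, map_mul, map_div₀, permRF_XX, permRF_CC, permRF_permRF, this]

lemma shiftRF_exch (ℏ c : ℂ) {p q t : Fin ℓ} (hp : p ≠ t) (hq : q ≠ t) (f : RF ℓ) :
    shiftRF t c (exch ℏ p q f) = exch ℏ p q (shiftRF t c f) := by
  unfold exch
  rw [permRF_shiftRF, Equiv.swap_apply_of_ne_of_ne hp.symm hq.symm]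
  simp [hp, hq]

lemma exch_comm (ℏ : ℂ) {p q r s : Fin ℓ} (hpr : p ≠ r) (hps : p ≠ s) (hqr : q ≠ r)
    (hqs : q ≠ s) (f : RF ℓ) :
    exch ℏ p q (exch ℏ r s f) = exch ℏ r s (exch ℏ p q f) := by
  have hc := swap_mul_swap_comm hpr hps hqr hqs
  unfold exch
  simp only [map_sub, map_add, map_mul, map_div₀, permRF_XX, permRF_CC, permRF_permRF, hc,
    Equiv.swap_apply_of_ne_of_ne hpr hps, Equiv.swap_apply_of_ne_of_ne hqr hqs,
    Equiv.swap_apply_of_ne_of_ne hpr.symm hqr.symm,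
    Equiv.swap_apply_of_ne_of_ne hps.symm hqs.symm]
  simp only [div_eq_mul_inv]
  ring

lemma braid_identity {K : Type*} [Field K] {x y z : K} (h f f₁ f₂ f₁₂ f₂₁ f₁₂₁ : K)
    (hxy : x - y ≠ 0) (hxz : x - z ≠ 0) (hyz : y - z ≠ 0) :
    ((x - y + h) * (((x - z + h) * (((y - z + h) * f₁₂₁ - h * f₁₂) / (y - z)) -
        h * (((y - x + h) * f - h * f₁) / (y - x))) / (x - z)) -
      h * (((y - z + h) * (((x - z + h) * f₂₁ - h * f₂) / (x - z)) -
        h * (((x - y + h) * f₁ - h * f) / (x - y))) / (y - z))) / (x - y) =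
    ((y - z + h) * (((x - z + h) * (((x - y + h) * f₁₂₁ - h * f₂₁) / (x - y)) -
        h * (((z - y + h) * f - h * f₂) / (z - y))) / (x - z)) -
      h * (((x - y + h) * (((x - z + h) * f₁₂ - h * f₁) / (x - z)) -
        h * (((y - z + h) * f₂ - h * f) / (y - z))) / (x - y))) / (y - z) := by
  have hyx : y - x = -(x - y) := by ring
  have hzy : z - y = -(y - z) := by ring
  rw [hyx, hzy]
  obtain ⟨u, rfl⟩ : ∃ u, x = y + u := ⟨x - y, by ring⟩
  obtain ⟨v, rfl⟩ : ∃ v, y = z + v := ⟨y - z, by ring⟩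
  have e1 : z + v + u - z = u + v := by ring
  simp only [add_sub_cancel_left, e1] at *
  field_simp
  ring

lemma exch_braid (ℏ : ℂ) {p q r : Fin ℓ} (hpq : p ≠ q) (hpr : p ≠ r) (hqr : q ≠ r) (f : RF ℓ) :
    exch ℏ p q (exch ℏ q r (exch ℏ p q f)) = exch ℏ q r (exch ℏ p q (exch ℏ q r f)) := by
  have h1 := XX_sub_XX_ne_zero hpq
  have h2 := XX_sub_XX_ne_zero hpr
  have h3 := XX_sub_XX_ne_zero hqr
  have hb : permRF (Equiv.swap q r) (permRF (Equiv.swap p q) (permRF (Equiv.swap q r) f)) =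
      permRF (Equiv.swap p q) (permRF (Equiv.swap q r) (permRF (Equiv.swap p q) f)) := by
    simp only [permRF_permRF]
    rw [swap_braid hpq hpr hqr]
  unfold exch
  simp only [map_sub, map_add, map_mul, map_div₀, permRF_XX, permRF_CC, permRF_swap_swap,
    Equiv.swap_apply_left, Equiv.swap_apply_right,
    Equiv.swap_apply_of_ne_of_ne hpr.symm hqr.symm, Equiv.swap_apply_of_ne_of_ne hpq hpr, hb]
  exact braid_identity _ _ _ _ _ _ _ h1 h2 h3

end Exchange

section Family

variable {ℓ : ℕ}

/-- The product of `1 / (α_a − α_b − ℏ)` over all `a < b` with `u a ≠ u b`. -/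
noncomputable def eProd (ℏ : ℂ) (u : Fin ℓ → ℕ) : RF ℓ :=
  ∏ ab : Fin ℓ × Fin ℓ,
    if ab.1 < ab.2 ∧ u ab.1 ≠ u ab.2 then (XX ab.1 - XX ab.2 - CC ℏ)⁻¹ else 1

lemma permRF_eProd (ℏ : ℂ) {u : Fin ℓ → ℕ} {p q : Fin ℓ} (hpq : (q : ℕ) = p + 1)
    (hu : u p = u q) : permRF (Equiv.swap p q) (eProd ℏ u) = eProd ℏ u := by
  unfold eProd
  rw [map_prod, ← Equiv.prod_comp (Equiv.prodCongr (Equiv.swap p q) (Equiv.swap p q))]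
  refine Finset.prod_congr rfl fun ab _ => ?_
  obtain ⟨a, b⟩ := ab
  have hu' : ∀ x, u (Equiv.swap p q x) = u x := by
    intro x
    by_cases h1 : x = p
    · simp [h1, hu]
    by_cases h2 : x = q
    · simp [h2, hu]
    rw [Equiv.swap_apply_of_ne_of_ne h1 h2]
  have hlt : u a ≠ u b → (Equiv.swap p q a < Equiv.swap p q b ↔ a < b) := by
    intro h
    simp only [Equiv.swap_apply_def]
    split_ifs with h1 h2 h3 h4 h5 h6 h7 <;> subst_vars <;>
      simp_all only [Fin.lt_def, Fin.ext_iff, ne_eq, not_true_eq_false, not_false_eq_true] <;> omega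
  simp only [Equiv.prodCongr_apply, Prod.map_apply, hu']
  by_cases h : u a = u b
  · simp [h]
  · simp only [hlt h, h, ne_eq, not_false_eq_true, and_true]
    split_ifs <;> simp

/-- A measure of disorder that drops when a descent is sorted. -/
def disorder (u : Fin ℓ → ℕ) : ℕ := ∑ a, (ℓ - a) * u a

lemma disorder_swap_lt {u : Fin ℓ → ℕ} {p q : Fin ℓ} (hpq : (q : ℕ) = p + 1)
    (hu : u q < u p) : disorder (u ∘ Equiv.swap p q) < disorder u := by
  have hne : p ≠ q := by rw [ne_eq, Fin.ext_iff]; omega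
  have h1 : q ∈ Finset.univ.erase p := by simp [hne.symm]
  have hp := p.isLt
  have hq := q.isLt
  unfold disorder
  rw [← Finset.add_sum_erase _ _ (Finset.mem_univ p), ← Finset.add_sum_erase _ _ h1,
    ← Finset.add_sum_erase Finset.univ (fun a : Fin ℓ => (ℓ - (a : ℕ)) * u a) (Finset.mem_univ p),
    ← Finset.add_sum_erase (Finset.univ.erase p) (fun a : Fin ℓ => (ℓ - (a : ℕ)) * u a) h1,
    Finset.sum_congr rfl (g := fun a : Fin ℓ => (ℓ - (a : ℕ)) * u a)]
  · obtain ⟨c, hc⟩ : ∃ c, ℓ - (p : ℕ) = c + 1 := ⟨ℓ - p - 1, by omega⟩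
    have hc' : ℓ - (q : ℕ) = c := by omega
    simp only [Function.comp_apply, Equiv.swap_apply_left, Equiv.swap_apply_right, hc, hc']
    nlinarith
  · intro x hx
    simp only [Finset.mem_erase, Finset.mem_univ, and_true] at hx
    simp [Equiv.swap_apply_of_ne_of_ne hx.2 hx.1]

/-- The family obtained from `eProd` on sorted tuples by sorting descents with `exch`. -/
noncomputable def hFun (ℏ : ℂ) (u : Fin ℓ → ℕ) : RF ℓ :=
  open Classical in
  if hd : ∃ pq : Fin ℓ × Fin ℓ, (pq.2 : ℕ) = pq.1 + 1 ∧ u pq.2 < u pq.1 then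
    exch ℏ hd.choose.1 hd.choose.2 (hFun ℏ (u ∘ Equiv.swap hd.choose.1 hd.choose.2))
  else eProd ℏ u
termination_by disorder u
decreasing_by exact disorder_swap_lt hd.choose_spec.1 hd.choose_spec.2

lemma exists_hFun_eq_exch (ℏ : ℂ) {u : Fin ℓ → ℕ} {p q : Fin ℓ} (hpq : (q : ℕ) = p + 1)
    (hu : u q < u p) : ∃ p' q' : Fin ℓ, (q' : ℕ) = p' + 1 ∧ u q' < u p' ∧
      hFun ℏ u = exch ℏ p' q' (hFun ℏ (u ∘ Equiv.swap p' q')) := by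
  have hd : ∃ pq : Fin ℓ × Fin ℓ, (pq.2 : ℕ) = pq.1 + 1 ∧ u pq.2 < u pq.1 := ⟨(p, q), hpq, hu⟩
  refine ⟨_, _, hd.choose_spec.1, hd.choose_spec.2, ?_⟩
  rw [hFun, dif_pos hd]

lemma hFun_eq_eProd (ℏ : ℂ) {u : Fin ℓ → ℕ}
    (hu : ∀ p q : Fin ℓ, (q : ℕ) = p + 1 → u p ≤ u q) : hFun ℏ u = eProd ℏ u := by
  rw [hFun, dif_neg]
  rintro ⟨⟨p, q⟩, h1, h2⟩
  exact absurd (hu p q h1) (not_le.2 h2)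

lemma comp_swap_braid (u : Fin ℓ → ℕ) {p q r : Fin ℓ} (hpq : p ≠ q) (hpr : p ≠ r)
    (hqr : q ≠ r) :
    ((u ∘ Equiv.swap p q) ∘ Equiv.swap q r) ∘ Equiv.swap p q =
      ((u ∘ Equiv.swap q r) ∘ Equiv.swap p q) ∘ Equiv.swap q r := by
  have hs : Equiv.swap q r * (Equiv.swap p q * Equiv.swap q r) =
      Equiv.swap p q * (Equiv.swap q r * Equiv.swap p q) := swap_braid hpq hpr hqr
  funext x
  have := DFunLike.congr_fun hs x
  simp only [Equiv.Perm.mul_apply] at this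
  simp only [Function.comp_apply, this]

lemma comp_swap_comm (u : Fin ℓ → ℕ) {p q r s : Fin ℓ} (hpr : p ≠ r) (hps : p ≠ s)
    (hqr : q ≠ r) (hqs : q ≠ s) :
    (u ∘ Equiv.swap p q) ∘ Equiv.swap r s = (u ∘ Equiv.swap r s) ∘ Equiv.swap p q := by
  funext x
  have := DFunLike.congr_fun (swap_mul_swap_comm hpr hps hqr hqs) x
  simp only [Equiv.Perm.mul_apply] at this
  simp only [Function.comp_apply, this]

/-- Sorting any descent of `u` recovers `hFun u`, and `hFun u` is fixed by the exchange of two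
equal adjacent entries. -/
def ExchCompatible (ℏ : ℂ) (u : Fin ℓ → ℕ) : Prop :=
  ∀ p q : Fin ℓ, (q : ℕ) = p + 1 →
    (u q < u p → hFun ℏ u = exch ℏ p q (hFun ℏ (u ∘ Equiv.swap p q))) ∧
      (u p = u q → exch ℏ p q (hFun ℏ u) = hFun ℏ u)

lemma exch_hFun_eq_of_descents {ℏ : ℂ} {u : Fin ℓ → ℕ}
    (ih : ∀ v : Fin ℓ → ℕ, disorder v < disorder u → ExchCompatible ℏ v)
    {p q r s : Fin ℓ} (hpq : (q : ℕ) = p + 1) (hrs : (s : ℕ) = r + 1) (hpr : p ≤ r)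
    (hu : u q < u p) (hu' : u s < u r) :
    exch ℏ p q (hFun ℏ (u ∘ Equiv.swap p q)) = exch ℏ r s (hFun ℏ (u ∘ Equiv.swap r s)) := by
  have d1 := disorder_swap_lt hpq hu
  have d2 := disorder_swap_lt hrs hu'
  have npq : p ≠ q := by rw [ne_eq, Fin.ext_iff]; omega
  have nrs : r ≠ s := by rw [ne_eq, Fin.ext_iff]; omega
  rcases hpr.eq_or_lt with rfl | hlt
  · obtain rfl : q = s := Fin.ext (by omega)
    rfl
  have nps : p ≠ s := by rw [ne_eq, Fin.ext_iff]; rw [Fin.lt_def] at hlt; omega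
  have nqs : q ≠ s := by rw [ne_eq, Fin.ext_iff]; rw [Fin.lt_def] at hlt; omega
  by_cases hqr : q = r
  · subst hqr
    have e1 : (u ∘ Equiv.swap p q) s < (u ∘ Equiv.swap p q) q := by
      simpa [Equiv.swap_apply_of_ne_of_ne nps.symm nrs.symm] using hu'.trans hu
    have e2 : ((u ∘ Equiv.swap p q) ∘ Equiv.swap q s) q <
        ((u ∘ Equiv.swap p q) ∘ Equiv.swap q s) p := by
      simpa [Equiv.swap_apply_of_ne_of_ne nps.symm nrs.symm,
        Equiv.swap_apply_of_ne_of_ne npq nps] using hu'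
    have e3 : (u ∘ Equiv.swap q s) q < (u ∘ Equiv.swap q s) p := by
      simpa [Equiv.swap_apply_of_ne_of_ne npq nps] using hu'.trans hu
    have e4 : ((u ∘ Equiv.swap q s) ∘ Equiv.swap p q) s <
        ((u ∘ Equiv.swap q s) ∘ Equiv.swap p q) q := by
      simpa [Equiv.swap_apply_of_ne_of_ne nps.symm nrs.symm,
        Equiv.swap_apply_of_ne_of_ne npq nps] using hu
    rw [(ih _ d1 q s hrs).1 e1,
      (ih _ ((disorder_swap_lt hrs e1).trans d1) p q hpq).1 e2,
      (ih _ d2 p q hpq).1 e3,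
      (ih _ ((disorder_swap_lt hpq e3).trans d2) q s hrs).1 e4,
      exch_braid ℏ npq nps nrs, comp_swap_braid u npq nps nrs]
  · have npr : p ≠ r := hlt.ne
    have e1 : (u ∘ Equiv.swap p q) s < (u ∘ Equiv.swap p q) r := by
      simpa [Equiv.swap_apply_of_ne_of_ne nps.symm nqs.symm,
        Equiv.swap_apply_of_ne_of_ne npr.symm (Ne.symm hqr)] using hu'
    have e2 : (u ∘ Equiv.swap r s) q < (u ∘ Equiv.swap r s) p := by
      simpa [Equiv.swap_apply_of_ne_of_ne hqr nqs,
        Equiv.swap_apply_of_ne_of_ne npr nps] using hu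
    rw [(ih _ d1 r s hrs).1 e1, (ih _ d2 p q hpq).1 e2, exch_comm ℏ npr nps hqr nqs,
      comp_swap_comm u npr nps hqr nqs]

lemma exchCompatible (ℏ : ℂ) (u : Fin ℓ → ℕ) : ExchCompatible ℏ u := by
  induction h : disorder u using Nat.strong_induction_on generalizing u with
  | _ n IH =>
  have ih : ∀ v : Fin ℓ → ℕ, disorder v < disorder u → ExchCompatible ℏ v :=
    fun v hv => IH _ (h ▸ hv) v rfl
  clear IH h
  intro p q hpq
  have npq : p ≠ q := by rw [ne_eq, Fin.ext_iff]; omega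
  refine ⟨fun hu => ?_, fun hu => ?_⟩
  · obtain ⟨r, s, hrs, hu', he⟩ := exists_hFun_eq_exch ℏ hpq hu
    rw [he]
    rcases le_total p r with hle | hle
    · exact (exch_hFun_eq_of_descents ih hpq hrs hle hu hu').symm
    · exact exch_hFun_eq_of_descents ih hrs hpq hle hu' hu
  · by_cases hd : ∀ p q : Fin ℓ, (q : ℕ) = p + 1 → u p ≤ u q
    · rw [hFun_eq_eProd ℏ hd]
      exact exch_eq_self ℏ npq (permRF_eProd ℏ hpq hu)
    · push Not at hd
      obtain ⟨r₀, s₀, hrs₀, hu₀⟩ := hd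
      obtain ⟨r, s, hrs, hu', he⟩ := exists_hFun_eq_exch ℏ hrs₀ hu₀
      clear hrs₀ hu₀ r₀ s₀
      have d1 := disorder_swap_lt hrs hu'
      have nrs : r ≠ s := by rw [ne_eq, Fin.ext_iff]; omega
      have npr : p ≠ r := by
        rintro rfl
        obtain rfl : q = s := Fin.ext (by omega)
        omega
      have nqs : q ≠ s := by rw [ne_eq, Fin.ext_iff] at *; omega
      by_cases hqr : q = r
      · subst hqr
        have nps : p ≠ s := by rw [ne_eq, Fin.ext_iff]; omega
        have e1 : (u ∘ Equiv.swap q s) q < (u ∘ Equiv.swap q s) p := by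
          simpa [Equiv.swap_apply_of_ne_of_ne npq nps, hu] using hu'
        have e2 : ((u ∘ Equiv.swap q s) ∘ Equiv.swap p q) q =
            ((u ∘ Equiv.swap q s) ∘ Equiv.swap p q) s := by
          simpa [Equiv.swap_apply_of_ne_of_ne nps.symm nrs.symm,
            Equiv.swap_apply_of_ne_of_ne npq nps] using hu
        have e3 := (ih _ ((disorder_swap_lt hpq e1).trans d1) q s hrs).2 e2
        rw [he, (ih _ d1 p q hpq).1 e1, exch_braid ℏ npq nps nrs, e3]
      by_cases hps : p = s
      · subst hps
        have nrq : r ≠ q := by rw [ne_eq, Fin.ext_iff]; omega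
        have e1 : (u ∘ Equiv.swap r p) q < (u ∘ Equiv.swap r p) p := by
          simpa [Equiv.swap_apply_of_ne_of_ne nrq.symm npq.symm, ← hu] using hu'
        have e2 : ((u ∘ Equiv.swap r p) ∘ Equiv.swap p q) r =
            ((u ∘ Equiv.swap r p) ∘ Equiv.swap p q) p := by
          simpa [Equiv.swap_apply_of_ne_of_ne nrs nrq,
            Equiv.swap_apply_of_ne_of_ne nrq.symm npq.symm] using hu
        have e3 := (ih _ ((disorder_swap_lt hpq e1).trans d1) r p hrs).2 e2
        rw [he, (ih _ d1 p q hpq).1 e1, ← exch_braid ℏ nrs nrq npq, e3]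
      · rw [he, exch_comm ℏ npr hps hqr nqs, (ih _ d1 p q hpq).2]
        simpa [Equiv.swap_apply_of_ne_of_ne npr hps,
          Equiv.swap_apply_of_ne_of_ne hqr nqs] using hu

lemma hFun_comp_swap (ℏ : ℂ) (u : Fin ℓ → ℕ) {p q : Fin ℓ} (hpq : (q : ℕ) = p + 1) :
    hFun ℏ (u ∘ Equiv.swap p q) = exch ℏ p q (hFun ℏ u) := by
  have npq : p ≠ q := by rw [ne_eq, Fin.ext_iff]; omega
  rcases lt_trichotomy (u p) (u q) with h | h | h
  · have := (exchCompatible ℏ (u ∘ Equiv.swap p q) p q hpq).1 (by simpa using h)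
    rw [this]
    congr 2
    funext x
    simp
  · have h2 : u ∘ Equiv.swap p q = u := by
      funext x
      by_cases h1 : x = p
      · simp [h1, h]
      by_cases h2 : x = q
      · simp [h2, h]
      simp [Equiv.swap_apply_of_ne_of_ne h1 h2]
    rw [h2, (exchCompatible ℏ u p q hpq).2 h]
  · rw [(exchCompatible ℏ u p q hpq).1 h, exch_exch ℏ npq]

end Family

section Passing

variable {K : Type*} [Field K] {m : ℕ}

/-- Lagrange-type sum interpolating between the two ends of a passage of one variable
through a block of `m` variables. -/
def passSum (h : K) (y : Fin (m + 1) → K) (P : Polynomial K) (j : Fin (m + 1)) : K :=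
  h * ∑ b, P.eval (y b + h) / (∏ a ∈ Finset.univ.erase b, (y b - y a)) *
    ((∏ a ∈ Finset.Iio j, (y b - y a) / (y b + h - y a)) / (y b + h - y j))

lemma exchange_partial_fraction {h u v z : K} (c Q : K) (huv : u - v ≠ 0)
    (hzu : z + h - u ≠ 0) (hzv : z + h - v ≠ 0) :
    ((u - v + h) * (c * (Q / (z + h - v))) - h * (c * (Q / (z + h - u)))) / (u - v) =
      c * ((z - u) / (z + h - u) * Q / (z + h - v)) := by
  obtain ⟨w, rfl⟩ : ∃ w, u = v + w := ⟨u - v, by ring⟩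
  rw [add_sub_cancel_left] at *
  field_simp
  ring

lemma exchange_passSum {h : K} {y : Fin (m + 1) → K} {P : Polynomial K} (i : Fin m)
    (hy : Function.Injective y) (hyh : ∀ a b, y a + h - y b ≠ 0) (s : K →+* K)
    (hs : ∀ a, s (y a) = y (Equiv.swap i.castSucc i.succ a)) (hsh : s h = h)
    (hP : P.map s = P) :
    ((y i.castSucc - y i.succ + h) * s (passSum h y P i.castSucc) -
      h * passSum h y P i.castSucc) / (y i.castSucc - y i.succ) = passSum h y P i.succ := by
  set σ := Equiv.swap i.castSucc i.succ with hσ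
  have hσσ : ∀ a, σ (σ a) = a := fun a => Equiv.swap_apply_self _ _ a
  have hlast : ∀ z : K, s (P.eval z) = P.eval (s z) := by
    intro z
    conv_rhs => rw [← hP, Polynomial.eval_map_apply]
  have h1 : s (passSum h y P i.castSucc) =
      h * ∑ b, P.eval (y b + h) / (∏ a ∈ Finset.univ.erase b, (y b - y a)) *
        ((∏ a ∈ Finset.Iio i.castSucc, (y b - y a) / (y b + h - y a)) /
          (y b + h - y i.succ)) := by
    unfold passSum
    rw [map_mul, hsh, map_sum, ← Equiv.sum_comp σ]
    congr 1
    refine Finset.sum_congr rfl fun b _ => ?_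
    simp only [map_mul, map_div₀, map_prod, hlast, map_add, map_sub, hs, hsh, hσσ]
    congr 2
    · refine Finset.prod_nbij' σ σ ?_ ?_ ?_ ?_ ?_
      · intro a ha
        simp only [Finset.mem_erase, Finset.mem_univ, and_true] at ha ⊢
        rintro rfl
        exact ha (hσσ a).symm
      · intro a ha
        simp only [Finset.mem_erase, Finset.mem_univ, and_true] at ha ⊢
        exact fun h => ha (σ.injective h)
      · simp [hσσ]
      · simp [hσσ]
      · simp
    · refine Finset.prod_congr rfl fun a ha => ?_
      rw [Finset.mem_Iio, Fin.lt_def, Fin.val_castSucc] at ha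
      rw [hσ, Equiv.swap_apply_of_ne_of_ne]
      · rw [ne_eq, Fin.ext_iff, Fin.val_castSucc]; omega
      · rw [ne_eq, Fin.ext_iff, Fin.val_succ]; omega
    · rw [hσ, Equiv.swap_apply_left]
  have hne : y i.castSucc - y i.succ ≠ 0 := by
    refine sub_ne_zero.2 fun h => ?_
    have := hy h
    rw [Fin.ext_iff, Fin.val_castSucc, Fin.val_succ] at this
    omega
  have hI : Finset.Iio i.succ = insert i.castSucc (Finset.Iio i.castSucc) := by
    ext a
    simp only [Finset.mem_Iio, Finset.mem_insert, Fin.lt_def, Fin.ext_iff, Fin.val_castSucc,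
      Fin.val_succ]
    omega
  rw [h1]
  unfold passSum
  rw [hI, mul_left_comm, ← mul_sub, mul_div_assoc]
  congr 1
  rw [Finset.mul_sum, Finset.mul_sum, ← Finset.sum_sub_distrib, Finset.sum_div]
  refine Finset.sum_congr rfl fun b _ => ?_
  rw [exchange_partial_fraction _ _ hne (hyh _ _) (hyh _ _), Finset.prod_insert (by simp)]

lemma passSum_zero {h : K} {y : Fin (m + 1) → K} {P : Polynomial K}
    (hy : Function.Injective y) (hyh : ∀ a b, y a + h - y b ≠ 0)
    (hP : P.degree < ((m + 1 : ℕ) : WithBot ℕ)) :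
    passSum h y P 0 = P.eval (y 0) * ∏ i : Fin m, (y 0 - y i.succ - h)⁻¹ := by
  have h0 : h ≠ 0 := by simpa using hyh 0 0
  have hz : Set.InjOn (fun b => y b + h) (Finset.univ : Finset (Fin (m + 1))) :=
    fun a _ b _ hab => hy (add_right_cancel hab)
  have hnode : ∀ b ∈ (Finset.univ : Finset (Fin (m + 1))), y 0 ≠ y b + h := by
    intro b _ hb
    exact hyh b 0 (by rw [← hb, sub_self])
  have hprod : ∏ i : Fin m, (y 0 - y i.succ - h) ≠ 0 := by
    refine Finset.prod_ne_zero_iff.2 fun i _ => ?_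
    have := hyh i.succ 0
    rw [← neg_ne_zero]
    convert this using 1
    ring
  have hL := Lagrange.eq_interpolate hz (f := P) (by simpa using hP)
  have hL' := congrArg (Polynomial.eval (y 0)) hL
  rw [Lagrange.eval_interpolate_not_at_node _ hnode, Lagrange.eval_nodal,
    Fin.prod_univ_succ] at hL'
  have hnode : ∀ i : Fin m, y 0 - (y i.succ + h) = y 0 - y i.succ - h := fun i => by ring
  simp only [hnode, sub_add_cancel_left] at hL'
  rw [hL', Finset.prod_inv_distrib, mul_right_comm, mul_assoc (-h), mul_inv_cancel₀ hprod, mul_one]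
  unfold passSum
  rw [neg_mul, ← mul_neg, ← Finset.sum_neg_distrib]
  congr 1
  refine Finset.sum_congr rfl fun b _ => ?_
  have h3 : y 0 - (y b + h) = -(y b + h - y 0) := by ring
  simp only [Lagrange.nodalWeight, add_sub_add_right_eq_sub, Finset.prod_inv_distrib, h3]
  rw [show Finset.Iio (0 : Fin (m + 1)) = ∅ by ext; simp, Finset.prod_empty, inv_neg]
  ring

lemma passSum_last {h : K} {y : Fin (m + 1) → K} {P : Polynomial K}
    (hy : Function.Injective y) (hyh : ∀ a b, y a + h - y b ≠ 0) :
    passSum h y P (Fin.last m) =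
      P.eval (y (Fin.last m) + h) * ∏ i : Fin m, (y (Fin.last m) - y i.castSucc + h)⁻¹ := by
  have h0 : h ≠ 0 := by simpa using hyh 0 0
  have hI : Finset.Iio (Fin.last m) = Finset.univ.erase (Fin.last m) := by
    ext a
    rw [Finset.mem_Iio, Fin.lt_last_iff_ne_last, Finset.mem_erase]
    simp
  have hE : ∀ f : Fin (m + 1) → K, ∏ a ∈ Finset.univ.erase (Fin.last m), f a =
      ∏ i : Fin m, f i.castSucc := by
    intro f
    have : Finset.univ.erase (Fin.last m) = Finset.univ.map Fin.castSuccEmb := by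
      ext a
      simp [Fin.exists_castSucc_eq]
    rw [this, Finset.prod_map]
    rfl
  unfold passSum
  rw [Finset.sum_eq_single (Fin.last m)]
  · have hprod : ∏ i : Fin m, (y (Fin.last m) - y i.castSucc) ≠ 0 := by
      refine Finset.prod_ne_zero_iff.2 fun i _ => sub_ne_zero.2 fun h => ?_
      exact Fin.castSucc_ne_last i (hy h).symm
    rw [hI, hE, hE, Finset.prod_div_distrib, add_sub_cancel_left, Finset.prod_inv_distrib]
    have : ∀ i : Fin m, y (Fin.last m) + h - y i.castSucc = y (Fin.last m) - y i.castSucc + h :=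
      fun i => by ring
    simp only [this]
    field_simp
  · intro b _ hb
    rw [Finset.prod_eq_zero (i := b) (Finset.mem_Iio.2 (Fin.lt_last_iff_ne_last.2 hb)) (by simp)]
    simp
  · simp

end Passing

section Tuples

variable {ℓ : ℕ}

/-- The tuple obtained from the sequence `v` by inserting the value `k` at position `t`. -/
def insTuple (ℓ : ℕ) (v : ℕ → ℕ) (k t : ℕ) : Fin ℓ → ℕ := fun a =>
  if (a : ℕ) < t then v a else if (a : ℕ) = t then k else v (a - 1)

lemma insTuple_comp_swap (v : ℕ → ℕ) (k : ℕ) {p q : Fin ℓ} (hpq : (q : ℕ) = p + 1) :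
    insTuple ℓ v k p ∘ Equiv.swap p q = insTuple ℓ v k (p + 1) := by
  funext a
  simp only [insTuple, Function.comp_apply, Equiv.swap_apply_def]
  split_ifs <;> simp_all [Fin.ext_iff] <;> omega

/-- The factor `α_b − α_t − ℏ` or `α_t − α_b − ℏ`, with the smaller position first. -/
def pairFactor (ℏ : ℂ) (t b : Fin ℓ) : RF ℓ :=
  if b < t then XX b - XX t - CC ℏ else XX t - XX b - CC ℏ

/-- The part of `eProd ℏ u` not involving the position `t`. -/
def eProdOff (ℏ : ℂ) (u : Fin ℓ → ℕ) (t : Fin ℓ) : RF ℓ :=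
  ∏ ab : Fin ℓ × Fin ℓ,
    if ab.1 < ab.2 ∧ u ab.1 ≠ u ab.2 ∧ ab.1 ≠ t ∧ ab.2 ≠ t then
      (XX ab.1 - XX ab.2 - CC ℏ)⁻¹ else 1

lemma eProd_eq_eProdOff_mul (ℏ : ℂ) (u : Fin ℓ → ℕ) (t : Fin ℓ) :
    eProd ℏ u = eProdOff ℏ u t * ∏ b, if u b ≠ u t then (pairFactor ℏ t b)⁻¹ else 1 := by
  have h1 : ∀ ab : Fin ℓ × Fin ℓ,
      (if ab.1 < ab.2 ∧ u ab.1 ≠ u ab.2 then (XX ab.1 - XX ab.2 - CC ℏ : RF ℓ)⁻¹ else 1) =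
      (if ab.1 < ab.2 ∧ u ab.1 ≠ u ab.2 ∧ ab.1 ≠ t ∧ ab.2 ≠ t then
        (XX ab.1 - XX ab.2 - CC ℏ : RF ℓ)⁻¹ else 1) *
      ((if ab.1 = t then (if t < ab.2 ∧ u ab.2 ≠ u t then
          (XX t - XX ab.2 - CC ℏ : RF ℓ)⁻¹ else 1) else 1) *
        (if ab.2 = t then (if ab.1 < t ∧ u ab.1 ≠ u t then
          (XX ab.1 - XX t - CC ℏ : RF ℓ)⁻¹ else 1) else 1)) := by
    rintro ⟨a, b⟩
    by_cases ha : a = t <;> by_cases hb : b = t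
    · simp [ha, hb]
    · simp [ha, hb, ne_comm (a := u t)]
    · simp [ha, hb]
    · simp [ha, hb]
  have h2 : ∀ b : Fin ℓ, (if u b ≠ u t then (pairFactor ℏ t b)⁻¹ else 1) =
      (if t < b ∧ u b ≠ u t then (XX t - XX b - CC ℏ : RF ℓ)⁻¹ else 1) *
        (if b < t ∧ u b ≠ u t then (XX b - XX t - CC ℏ : RF ℓ)⁻¹ else 1) := by
    intro b
    by_cases hu : u b = u t
    · simp [hu]
    · rcases lt_trichotomy b t with h | h | h
      · simp [pairFactor, h, hu, h.not_gt]
      · exact absurd (congrArg u h) hu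
      · simp [pairFactor, h, hu, h.not_gt]
  unfold eProd eProdOff
  simp only [h1, h2]
  rw [Finset.prod_mul_distrib, Finset.prod_mul_distrib, Finset.prod_mul_distrib]
  congr 2
  · rw [Fintype.prod_prod_type_right]
    refine Finset.prod_congr rfl fun b _ => ?_
    simp
  · rw [Fintype.prod_prod_type]
    refine Finset.prod_congr rfl fun a _ => ?_
    simp

lemma eProdOff_congr (ℏ : ℂ) {u w : Fin ℓ → ℕ} {t : Fin ℓ} (h : ∀ a, a ≠ t → u a = w a) :
    eProdOff ℏ u t = eProdOff ℏ w t := by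
  refine Finset.prod_congr rfl fun ab _ => ?_
  by_cases h1 : ab.1 = t
  · simp [h1]
  by_cases h2 : ab.2 = t
  · simp [h2]
  simp only [h _ h1, h _ h2]

lemma eProdOff_mul_prod (ℏ : ℂ) {u w : Fin ℓ → ℕ} {t : Fin ℓ} (h : ∀ a, a ≠ t → u a = w a) :
    eProdOff ℏ u t * ∏ b ∈ univ.erase t, (pairFactor ℏ t b)⁻¹ =
      eProd ℏ w * ∏ b ∈ univ.filter (fun b => b ≠ t ∧ w b = w t), (pairFactor ℏ t b)⁻¹ := by
  rw [eProd_eq_eProdOff_mul ℏ w t, eProdOff_congr ℏ h, mul_assoc]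
  congr 1
  rw [Finset.prod_filter, ← Finset.prod_mul_distrib, ← Finset.mul_prod_erase _ _ (mem_univ t)]
  simp only [ne_eq, not_true_eq_false, false_and, if_false, mul_one, one_mul]
  refine Finset.prod_congr rfl fun b hb => ?_
  have hb' := (Finset.mem_erase.1 hb).1
  by_cases hw : w b = w t <;> simp [hw, hb']

/-- The value of the family when one entry has been moved past whole blocks of a sorted tuple. -/
def movedProd (ℏ : ℂ) (u : Fin ℓ → ℕ) (t : Fin ℓ) (B : Finset (Fin ℓ)) (c q : ℤ) : RF ℓ :=
  (c : RF ℓ) * (eProdOff ℏ u t * ∏ b ∈ univ.erase t, (pairFactor ℏ t b)⁻¹) *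
    ∏ b ∈ B, (XX b - XX t - (q : RF ℓ) * CC ℏ)

lemma pairFactor_ne_zero {ℏ : ℂ} (hℏ : ℏ ≠ 0) (t b : Fin ℓ) : pairFactor ℏ t b ≠ 0 := by
  unfold pairFactor
  split_ifs <;> exact XX_sub_XX_sub_CC_ne_zero hℏ _ _

/-- The polynomial in the moving variable attached to a passage through a block. -/
def passPoly (ℏ : ℂ) (e : RF ℓ) (B : Finset (Fin ℓ)) (q : ℤ) : Polynomial (RF ℓ) :=
  Polynomial.C e * ∏ b ∈ B, (Polynomial.C (XX b - (q : RF ℓ) * CC ℏ) - Polynomial.X)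

lemma passPoly_eval (ℏ : ℂ) (e : RF ℓ) (B : Finset (Fin ℓ)) (q : ℤ) (z : RF ℓ) :
    (passPoly ℏ e B q).eval z = e * ∏ b ∈ B, (XX b - (q : RF ℓ) * CC ℏ - z) := by
  simp [passPoly, Polynomial.eval_prod]

lemma passPoly_degree_lt (ℏ : ℂ) (e : RF ℓ) {B : Finset (Fin ℓ)} (q : ℤ) {m : ℕ}
    (hB : B.card ≤ m) : (passPoly ℏ e B q).degree < ((m + 1 : ℕ) : WithBot ℕ) := by
  refine lt_of_le_of_lt Polynomial.degree_le_natDegree (Nat.cast_lt.2 (Nat.lt_succ_of_le ?_))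
  refine (Polynomial.natDegree_C_mul_le _ _).trans ((Polynomial.natDegree_prod_le _ _).trans ?_)
  refine (Finset.sum_le_card_nsmul _ _ 1 fun b _ => ?_).trans (by simpa using hB)
  refine (Polynomial.natDegree_sub_le _ _).trans ?_
  rw [Polynomial.natDegree_C, Polynomial.natDegree_X]
  exact le_rfl

lemma passPoly_map (ℏ : ℂ) {e : RF ℓ} {B : Finset (Fin ℓ)} (q : ℤ) {σ : Equiv.Perm (Fin ℓ)}
    (he : permRF σ e = e) (hB : ∀ b ∈ B, σ b = b) :
    (passPoly ℏ e B q).map (permRF σ) = passPoly ℏ e B q := by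
  unfold passPoly
  rw [Polynomial.map_mul, Polynomial.map_C, he, Polynomial.map_prod]
  congr 1
  refine Finset.prod_congr rfl fun b hb => ?_
  simp [hB b hb]

lemma exch_injective (ℏ : ℂ) {p q : Fin ℓ} (hpq : p ≠ q) : Function.Injective (exch ℏ p q) :=
  fun f g h => by rw [← exch_exch ℏ hpq f, h, exch_exch ℏ hpq]

/-- Moving an entry through a block: the exchange operators carry `passSum` along. -/
lemma hFun_insTuple_eq_passSum_iff {ℏ : ℂ} (hℏ : ℏ ≠ 0) (v : ℕ → ℕ) (k : ℕ) {p m : ℕ}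
    (hp : p + m < ℓ) {P : Polynomial (RF ℓ)}
    (hP : ∀ a b : Fin ℓ, (b : ℕ) = a + 1 → p ≤ a → (b : ℕ) ≤ p + m →
      P.map (permRF (Equiv.swap a b)) = P) (i : ℕ) (hi : i < m + 1) :
    hFun ℏ (insTuple ℓ v k p) =
        passSum (CC ℏ) (fun a : Fin (m + 1) => XX (⟨p + a, by omega⟩ : Fin ℓ)) P 0 ↔
      hFun ℏ (insTuple ℓ v k (p + i)) =
        passSum (CC ℏ) (fun a : Fin (m + 1) => XX (⟨p + a, by omega⟩ : Fin ℓ)) P ⟨i, hi⟩ := by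
  induction i with
  | zero => rfl
  | succ i ih =>
    rw [ih (by omega)]
    set f : Fin (m + 1) → Fin ℓ := fun a => ⟨p + a, by omega⟩ with hf
    have hfinj : Function.Injective f := by
      intro a b h
      simp only [hf, Fin.mk.injEq] at h
      exact Fin.ext (by omega)
    have hne : f (⟨i, by omega⟩ : Fin m).castSucc ≠ f (⟨i, by omega⟩ : Fin m).succ :=
      fun h => by simpa using hfinj h
    have h1 := insTuple_comp_swap v k (p := f (⟨i, by omega⟩ : Fin m).castSucc)
      (q := f (⟨i, by omega⟩ : Fin m).succ) (by simp [hf]; omega)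
    have h2 := exchange_passSum (h := (CC ℏ : RF ℓ)) (y := fun a => XX (f a)) (P := P)
      (⟨i, by omega⟩ : Fin m)
      (fun a b hab => by
        by_contra hne
        exact XX_sub_XX_ne_zero (fun h => hne (hfinj h)) (sub_eq_zero.2 hab))
      (fun a b => by
        have := XX_sub_XX_add_CC_ne_zero' hℏ (f a) (f b)
        rwa [sub_add_eq_add_sub] at this)
      (permRF (Equiv.swap (f (⟨i, by omega⟩ : Fin m).castSucc) (f (⟨i, by omega⟩ : Fin m).succ)))
      (fun a => by rw [permRF_XX, hfinj.map_swap])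
      (permRF_CC _ _)
      (hP _ _ (by simp [hf]; omega) (by simp [hf]) (by simp [hf]; omega))
    have h3 : insTuple ℓ v k (p + (i + 1)) = insTuple ℓ v k (p + i) ∘
        Equiv.swap (f (⟨i, by omega⟩ : Fin m).castSucc) (f (⟨i, by omega⟩ : Fin m).succ) :=
      h1.symm
    rw [h3, hFun_comp_swap ℏ _ (by simp [hf]; omega)]
    change _ ↔ _ = passSum (CC ℏ) (fun a => XX (f a)) P (⟨i, by omega⟩ : Fin m).succ
    rw [← h2]
    exact (exch_injective ℏ hne).eq_iff.symm

end Tuples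

section BlockPassing

variable {ℓ : ℕ}

lemma eProdOff_mul_prod_eq (ℏ : ℂ) {u w : Fin ℓ → ℕ} {t : Fin ℓ} (h : ∀ a, a ≠ t → u a = w a)
    {m : ℕ} (f : Fin m → Fin ℓ) (hf : Function.Injective f)
    (hw : ∀ b, (b ≠ t ∧ w b = w t) ↔ ∃ i, f i = b) :
    eProdOff ℏ u t * ∏ b ∈ univ.erase t, (pairFactor ℏ t b)⁻¹ =
      eProd ℏ w * ∏ i, (pairFactor ℏ t (f i))⁻¹ := by
  rw [eProdOff_mul_prod ℏ h]
  congr 1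
  have : univ.filter (fun b => b ≠ t ∧ w b = w t) = univ.map ⟨f, hf⟩ := by
    ext b
    simp [hw]
  rw [this, Finset.prod_map]
  rfl

/-- Moving an entry past a block of `m` equal entries multiplies by `(-1) ^ m` and shifts the
numerator factors by `ℏ`. -/
lemma hFun_insTuple_eq_movedProd_iff {ℏ : ℂ} (hℏ : ℏ ≠ 0) {v : ℕ → ℕ} (k : ℕ) {j p m : ℕ}
    (hp : p + m < ℓ) (hv : ∀ a, a + 1 < ℓ → (v a = j ↔ p ≤ a ∧ a < p + m))
    {B : Finset (Fin ℓ)} (hB : B.card ≤ m) (hB' : ∀ b ∈ B, (b : ℕ) < p ∨ p + m < b) (c q : ℤ) :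
    hFun ℏ (insTuple ℓ v k p) =
        movedProd ℏ (insTuple ℓ v k p) ⟨p, by omega⟩ B c q ↔
      hFun ℏ (insTuple ℓ v k (p + m)) =
        movedProd ℏ (insTuple ℓ v k (p + m)) ⟨p + m, hp⟩ B ((-1) ^ m * c) (q + 1) := by
  set w := insTuple ℓ v j p with hw
  have hwj : ∀ b : Fin ℓ, w b = j ↔ p ≤ b ∧ (b : ℕ) ≤ p + m := by
    intro b
    have hb := b.isLt
    simp only [hw, insTuple]
    split_ifs with h1 h2
    · rw [hv _ (by omega)]
      omega
    · simp
      omega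
    · rw [hv _ (by omega)]
      omega
  have hwp : ∀ a : Fin ℓ, a ≠ ⟨p, by omega⟩ → insTuple ℓ v k p a = w a := by
    intro a ha
    have ha' : (a : ℕ) ≠ p := fun h => ha (Fin.ext h)
    simp [hw, insTuple, ha']
  have hwm : ∀ a : Fin ℓ, a ≠ ⟨p + m, hp⟩ → insTuple ℓ v k (p + m) a = w a := by
    intro a ha
    have ha' : (a : ℕ) ≠ p + m := fun h => ha (Fin.ext h)
    have hal := a.isLt
    by_cases h : w a = j
    · rw [h]
      have h' := (hwj a).1 h
      rw [insTuple, if_pos (by omega), hv _ (by omega)]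
      omega
    · have h' := mt (hwj a).2 h
      simp only [insTuple, hw]
      by_cases h1 : (a : ℕ) < p
      · rw [if_pos h1, if_pos (by omega)]
      · rw [if_neg (by omega), if_neg (by omega), if_neg h1, if_neg (by omega)]
  set f : Fin (m + 1) → Fin ℓ := fun a => ⟨p + a, by omega⟩ with hf
  have hfinj : Function.Injective f := by
    intro a b h
    simp only [hf, Fin.mk.injEq] at h
    exact Fin.ext (by omega)
  have hy : Function.Injective fun a => (XX (f a) : RF ℓ) := fun a b hab => by
    by_contra hne
    exact XX_sub_XX_ne_zero (fun h => hne (hfinj h)) (sub_eq_zero.2 hab)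
  have hyh : ∀ a b, (XX (f a) : RF ℓ) + CC ℏ - XX (f b) ≠ 0 := fun a b => by
    have := XX_sub_XX_add_CC_ne_zero' hℏ (f a) (f b)
    rwa [sub_add_eq_add_sub] at this
  have key := hFun_insTuple_eq_passSum_iff hℏ v k hp
    (P := passPoly ℏ ((c : RF ℓ) * eProd ℏ w) B q) ?_ m (Nat.lt_succ_self m)
  · have e0 : passSum (CC ℏ) (fun a => XX (f a)) (passPoly ℏ ((c : RF ℓ) * eProd ℏ w) B q) 0 =
        movedProd ℏ (insTuple ℓ v k p) ⟨p, by omega⟩ B c q := by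
      rw [passSum_zero hy hyh (passPoly_degree_lt ℏ _ q hB), passPoly_eval, movedProd,
        eProdOff_mul_prod_eq ℏ hwp (fun i : Fin m => f i.succ)
          (hfinj.comp (Fin.succ_injective m))]
      · have e1 : ∀ i : Fin m, pairFactor ℏ (f 0) (f i.succ) =
            XX (f 0) - XX (f i.succ) - CC ℏ := by
          intro i
          rw [pairFactor, if_neg (by simp [hf, Fin.lt_def])]
        have e2 : (⟨p, by omega⟩ : Fin ℓ) = f 0 := rfl
        have e3 : ∀ b, (XX b : RF ℓ) - (q : RF ℓ) * CC ℏ - XX (f 0) =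
            XX b - XX (f 0) - (q : RF ℓ) * CC ℏ := fun b => sub_right_comm _ _ _
        simp only [e1, e2, e3]
        rw [mul_right_comm, ← mul_assoc]
      · intro b
        rw [(hwj ⟨p, by omega⟩).2 (by simp), hwj]
        constructor
        · rintro ⟨h1, h2, h3⟩
          have h1' : (b : ℕ) ≠ p := fun h => h1 (Fin.ext h)
          exact ⟨⟨b - p - 1, by omega⟩, Fin.ext (by simp [hf]; omega)⟩
        · rintro ⟨i, rfl⟩
          simp only [hf, Fin.val_succ, ne_eq, Fin.mk.injEq]
          omega
    have em : passSum (CC ℏ) (fun a => XX (f a)) (passPoly ℏ ((c : RF ℓ) * eProd ℏ w) B q)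
        (Fin.last m) =
        movedProd ℏ (insTuple ℓ v k (p + m)) ⟨p + m, hp⟩ B ((-1) ^ m * c) (q + 1) := by
      rw [passSum_last hy hyh, passPoly_eval, movedProd,
        eProdOff_mul_prod_eq ℏ hwm (fun i : Fin m => f i.castSucc)
          (hfinj.comp (Fin.castSucc_injective m))]
      · have e1 : ∀ i : Fin m, (pairFactor ℏ (f (Fin.last m)) (f i.castSucc))⁻¹ =
            (-1) * (XX (f (Fin.last m)) - XX (f i.castSucc) + CC ℏ)⁻¹ := by
          intro i
          rw [pairFactor, if_pos (by simp [hf, Fin.lt_def]), neg_one_mul, ← inv_neg]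
          congr 1
          ring
        have e2 : (⟨p + m, hp⟩ : Fin ℓ) = f (Fin.last m) := rfl
        have e3 : ∀ b, (XX b : RF ℓ) - (q : RF ℓ) * CC ℏ - (XX (f (Fin.last m)) + CC ℏ) =
            XX b - XX (f (Fin.last m)) - ((q + 1 : ℤ) : RF ℓ) * CC ℏ := by
          intro b
          push_cast
          ring
        have e4 : (((-1) ^ m * c : ℤ) : RF ℓ) * (-1) ^ m = c := by
          push_cast
          rw [mul_right_comm, ← mul_pow]
          simp
        simp only [e1, e2, e3]
        rw [Finset.prod_mul_distrib, Finset.prod_const, Finset.card_univ, Fintype.card_fin,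
          ← e4]
        generalize ∏ i : Fin m, (XX (f (Fin.last m)) - XX (f i.castSucc) + CC ℏ : RF ℓ)⁻¹ = x
        generalize eProd ℏ w = y
        generalize ∏ b ∈ B, (XX b - XX (f (Fin.last m)) - ((q + 1 : ℤ) : RF ℓ) * CC ℏ) = z
        generalize (((-1) ^ m * c : ℤ) : RF ℓ) = d
        generalize ((-1) ^ m : RF ℓ) = g
        ring
      · intro b
        rw [(hwj ⟨p + m, hp⟩).2 (by simp), hwj]
        constructor
        · rintro ⟨h1, h2, h3⟩
          have h1' : (b : ℕ) ≠ p + m := fun h => h1 (Fin.ext h)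
          exact ⟨⟨b - p, by omega⟩, Fin.ext (by simp [hf]; omega)⟩
        · rintro ⟨i, rfl⟩
          simp only [hf, Fin.val_castSucc, ne_eq, Fin.mk.injEq]
          omega
    rw [← e0, ← em]
    exact key
  · intro a b hab ha hb
    refine passPoly_map ℏ q ?_ fun x hx => ?_
    · rw [map_mul, map_intCast, permRF_eProd ℏ hab]
      rw [(hwj a).2 (by omega), (hwj b).2 (by omega)]
    · have := hB' x hx
      refine Equiv.swap_apply_of_ne_of_ne ?_ ?_ <;> rw [ne_eq, Fin.ext_iff] <;> omega

end BlockPassing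

section SortedTuples

variable {ℓ : ℕ}

lemma div_eq_iff_mul_le_and_lt {m : ℕ} (hm : 0 < m) (a j : ℕ) :
    a / m = j ↔ j * m ≤ a ∧ a < j * m + m := by
  rw [le_antisymm_iff, and_comm, Nat.le_div_iff_mul_le hm, ← Nat.lt_succ_iff (m := a / m),
    Nat.div_lt_iff_lt_mul hm, Nat.succ_mul]

/-- The sequence `a ↦ a / m` with one occurrence of `k` deleted. -/
def delSeq (m k a : ℕ) : ℕ := if a + 1 < k * m + m then a / m else (a + 1) / m

lemma delSeq_eq_iff_of_lt {m : ℕ} (hm : 0 < m) {k j : ℕ} (hkj : k < j) (a : ℕ) :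
    delSeq m k a = j ↔ j * m ≤ a + 1 ∧ a + 1 < j * m + m := by
  have h : k * m + m ≤ j * m := by rw [← Nat.succ_mul]; exact Nat.mul_le_mul_right m hkj
  unfold delSeq
  split_ifs with ha <;> rw [div_eq_iff_mul_le_and_lt hm]
  omega

lemma delSeq_eq_iff_of_gt {m : ℕ} (hm : 0 < m) {k j : ℕ} (hjk : j < k) (a : ℕ) :
    delSeq m k a = j ↔ j * m ≤ a ∧ a < j * m + m := by
  have h : j * m + m ≤ k * m := by rw [← Nat.succ_mul]; exact Nat.mul_le_mul_right m hjk
  unfold delSeq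
  split_ifs with ha <;> rw [div_eq_iff_mul_le_and_lt hm]
  omega

lemma insTuple_delSeq {m : ℕ} (hm : 0 < m) {k t : ℕ} (ht : k * m ≤ t) (ht' : t < k * m + m) :
    insTuple ℓ (delSeq m k) k t = fun a : Fin ℓ => (a : ℕ) / m := by
  funext a
  unfold insTuple delSeq
  split_ifs with h1 h2 h3 h4
  · rfl
  · omega
  · exact ((div_eq_iff_mul_le_and_lt hm _ _).2 (by omega)).symm
  · rw [(div_eq_iff_mul_le_and_lt hm ((a : ℕ) - 1) k).2 (by omega),
      (div_eq_iff_mul_le_and_lt hm (a : ℕ) k).2 (by omega)]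
  · rw [Nat.sub_add_cancel (by omega)]

/-- The positions `b` with `x ≤ b < y`. -/
def posIco (ℓ x y : ℕ) : Finset (Fin ℓ) := univ.filter fun b => x ≤ (b : ℕ) ∧ (b : ℕ) < y

lemma mem_posIco {x y : ℕ} {b : Fin ℓ} : b ∈ posIco ℓ x y ↔ x ≤ (b : ℕ) ∧ (b : ℕ) < y := by
  simp [posIco]

lemma card_posIco {x y : ℕ} (hy : y ≤ ℓ) : (posIco ℓ x y).card = y - x := by
  rw [← Nat.card_Ico]
  refine Finset.card_bij (fun b _ => (b : ℕ)) (fun b hb => Finset.mem_Ico.2 (mem_posIco.1 hb))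
    (fun a _ b _ h => Fin.ext h) fun b hb => ?_
  have := Finset.mem_Ico.1 hb
  exact ⟨⟨b, by omega⟩, mem_posIco.2 this, rfl⟩

lemma hFun_div_eq {ℏ : ℂ} (hℏ : ℏ ≠ 0) {m k : ℕ} (hm : 0 < m) (t : Fin ℓ) {B : Finset (Fin ℓ)}
    (ht : k * m ≤ t) (ht' : (t : ℕ) < k * m + m)
    (hB : ∀ b, b ∈ B ↔ b ≠ t ∧ k * m ≤ (b : ℕ) ∧ (b : ℕ) < k * m + m) :
    hFun ℏ (insTuple ℓ (delSeq m k) k t) =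
      eProdOff ℏ (insTuple ℓ (delSeq m k) k t) t * (∏ b ∈ univ.erase t, (pairFactor ℏ t b)⁻¹) *
        ∏ b ∈ B, pairFactor ℏ t b := by
  rw [insTuple_delSeq hm ht ht', hFun_eq_eProd ℏ fun p q hpq => Nat.div_le_div_right (by omega),
    eProdOff_mul_prod ℏ fun a _ => rfl]
  have : univ.filter (fun b : Fin ℓ => b ≠ t ∧ (b : ℕ) / m = (t : ℕ) / m) = B := by
    ext b
    rw [(div_eq_iff_mul_le_and_lt hm (t : ℕ) k).2 ⟨ht, ht'⟩, hB]
    simp [div_eq_iff_mul_le_and_lt hm]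
  rw [this, mul_assoc, ← Finset.prod_mul_distrib, Finset.prod_eq_one, mul_one]
  exact fun b _ => inv_mul_cancel₀ (pairFactor_ne_zero hℏ t b)

lemma hFun_move_iff {ℏ : ℂ} (hℏ : ℏ ≠ 0) {v : ℕ → ℕ} (k : ℕ) {j m : ℕ} {t t' : Fin ℓ}
    (ht : (t' : ℕ) = t + m) (hv : ∀ a, v a = j ↔ (t : ℕ) ≤ a ∧ a < (t : ℕ) + m)
    {B : Finset (Fin ℓ)} (hB : B.card ≤ m) (hB' : ∀ b ∈ B, b < t ∨ t' < b) (c q : ℤ) :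
    hFun ℏ (insTuple ℓ v k t) = movedProd ℏ (insTuple ℓ v k t) t B c q ↔
      hFun ℏ (insTuple ℓ v k t') = movedProd ℏ (insTuple ℓ v k t') t' B ((-1) ^ m * c) (q + 1) := by
  have hlt : (t : ℕ) + m < ℓ := ht ▸ t'.2
  obtain rfl : t' = ⟨t + m, hlt⟩ := Fin.ext ht
  exact hFun_insTuple_eq_movedProd_iff hℏ k hlt (fun a _ => hv a) hB (fun b hb => hB' b hb) c q

lemma hFun_insTuple_right {ℏ : ℂ} (hℏ : ℏ ≠ 0) {m : ℕ} (hm : 0 < m) (k i : ℕ) :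
    ∀ t : Fin ℓ, (t : ℕ) + 1 = (k + i) * m + m →
      hFun ℏ (insTuple ℓ (delSeq m k) k t) =
        movedProd ℏ (insTuple ℓ (delSeq m k) k t) t (posIco ℓ (k * m) (k * m + m - 1))
          ((-1) ^ (m * i)) (1 + i) := by
  induction i with
  | zero =>
    intro t ht
    rw [add_zero] at ht
    rw [hFun_div_eq hℏ hm t (B := posIco ℓ (k * m) (k * m + m - 1)) (by omega) (by omega)]
    · rw [movedProd]
      congr 1
      · simp
      · refine Finset.prod_congr rfl fun b hb => ?_
        have := mem_posIco.1 hb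
        rw [pairFactor, if_pos (by rw [Fin.lt_def]; omega)]
        simp
    · intro b
      rw [mem_posIco, ne_eq, Fin.ext_iff]
      omega
  | succ i ih =>
    intro t' ht'
    have h1 : (k + (i + 1)) * m = (k + i) * m + m := by ring
    have h2 : k * m ≤ (k + i) * m := Nat.mul_le_mul_right m (by omega)
    have hlt := t'.2
    have h3 := (hFun_move_iff hℏ k (v := delSeq m k) (j := k + (i + 1)) (m := m) (t' := t')
      (t := ⟨t' - m, by omega⟩) (by simp; omega) (fun a => ?_)
      ((card_posIco (by omega)).trans_le (by omega)) (fun b hb => ?_) _ _).1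
      (ih ⟨t' - m, by omega⟩ (by simp; omega))
    · rw [h3]
      congr 1
      ring
    · rw [delSeq_eq_iff_of_lt hm (by omega)]
      simp only
      omega
    · left
      have := mem_posIco.1 hb
      rw [Fin.lt_def]
      simp only
      omega

lemma hFun_insTuple_left {ℏ : ℂ} (hℏ : ℏ ≠ 0) {m : ℕ} (hm : 0 < m) (k i : ℕ) :
    ∀ (r : ℕ) (t : Fin ℓ), k = i + r → (t : ℕ) = r * m → k * m + m ≤ ℓ →
      hFun ℏ (insTuple ℓ (delSeq m k) k t) =
        movedProd ℏ (insTuple ℓ (delSeq m k) k t) t (posIco ℓ (k * m + 1) (k * m + m))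
          ((-1) ^ (m - 1 + m * i)) (-1 - i) := by
  induction i with
  | zero =>
    intro r t hr ht hk
    obtain rfl : k = r := by omega
    rw [hFun_div_eq hℏ hm t (B := posIco ℓ (k * m + 1) (k * m + m)) (by omega) (by omega)]
    · rw [movedProd]
      have h1 : ∀ b ∈ posIco ℓ (k * m + 1) (k * m + m), pairFactor ℏ t b =
          (-1) * (XX b - XX t - ((-1 - (0 : ℕ) : ℤ) : RF ℓ) * CC ℏ) := by
        intro b hb
        have := mem_posIco.1 hb
        rw [pairFactor, if_neg (by rw [Fin.lt_def]; omega)]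
        push_cast
        ring
      rw [Finset.prod_congr rfl h1, Finset.prod_mul_distrib, Finset.prod_const, card_posIco hk,
        show k * m + m - (k * m + 1) = m - 1 by omega]
      push_cast
      rw [mul_zero, add_zero]
      generalize eProdOff ℏ (insTuple ℓ (delSeq m k) k t) t = x
      generalize ∏ b ∈ univ.erase t, (pairFactor ℏ t b)⁻¹ = y
      generalize ∏ b ∈ posIco ℓ (k * m + 1) (k * m + m), (_ : RF ℓ) = z
      generalize (-1 : RF ℓ) ^ _ = g
      ring
    · intro b
      rw [mem_posIco, ne_eq, Fin.ext_iff]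
      omega
  | succ i ih =>
    intro r t hr ht hk
    have h1 : (r + 1) * m = r * m + m := by ring
    have h2 : (r + 1) * m ≤ k * m := Nat.mul_le_mul_right m (by omega)
    have h3 := ih (r + 1) ⟨t + m, by omega⟩ (by omega) (by simp; omega) hk
    refine (hFun_move_iff hℏ k (v := delSeq m k) (j := r) (t := t) (t' := ⟨t + m, by omega⟩) rfl
      (fun a => ?_) ((card_posIco hk).trans_le (by omega))
      (fun b hb => ?_) _ _).2 ?_
    · rw [delSeq_eq_iff_of_gt hm (by omega), ht]
    · right
      have := mem_posIco.1 hb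
      rw [Fin.lt_def]
      simp only
      omega
    · rw [h3]
      congr 1
      · have : ((-1 : ℤ) ^ m) ^ 2 = 1 := by rw [← pow_mul, mul_comm, pow_mul]; simp
        rw [mul_add m i 1, mul_one, ← add_assoc, pow_add (-1 : ℤ) (_ + m * i) m]
        linear_combination -(-1 : ℤ) ^ (_ + m * i) * this
      · push_cast
        ring

end SortedTuples

section Rotation

variable {ℓ : ℕ}

lemma val_finRotate_symm (a : Fin ℓ) :
    (((finRotate ℓ).symm a : Fin ℓ) : ℕ) = if (a : ℕ) = 0 then ℓ - 1 else a - 1 := by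
  cases ℓ with
  | zero => exact a.elim0
  | succ n =>
    obtain ⟨b, rfl⟩ := (finRotate (n + 1)).surjective a
    rw [Equiv.symm_apply_apply, coe_finRotate]
    by_cases hb : b = Fin.last n
    · simp [hb]
    · simp [hb]

lemma insTuple_comp_finRotate_symm (v : ℕ → ℕ) (k : ℕ) {t : Fin ℓ} (ht : (t : ℕ) = ℓ - 1) :
    insTuple ℓ v k t ∘ (finRotate ℓ).symm = insTuple ℓ v k 0 := by
  funext a
  have ha := a.isLt
  simp only [Function.comp_apply, insTuple, val_finRotate_symm]
  by_cases h : (a : ℕ) = 0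
  · simp [h, ht]
  · rw [if_neg h, if_pos (by omega), if_neg (by omega), if_neg h]

/-- The relation `HRel2` for the value of the family at a single tuple. -/
def ShiftRel (N : ℕ) (ℏ : ℂ) (t : Fin ℓ) (u : Fin ℓ → ℕ) : Prop :=
  shiftRF t (-((N : ℂ) * ℏ)) (hFun ℏ u) =
    (∏ a ∈ univ.erase t,
      ((XX a - XX t + CC ℏ) / (XX a - XX t + CC (((N : ℂ) - 1) * ℏ)))) *
      permRF (finRotate ℓ).symm (hFun ℏ (u ∘ (finRotate ℓ).symm))

lemma CC_sub_one_mul (N : ℕ) (ℏ : ℂ) :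
    (CC (((N : ℂ) - 1) * ℏ) : RF ℓ) = (N : RF ℓ) * CC ℏ - CC ℏ := by
  have h : ((N : ℂ) - 1) * ℏ = (N : ℂ) * ℏ + (-ℏ) := by ring
  rw [h, CC_eq_ccHom, map_add, ← CC_eq_ccHom, ← CC_eq_ccHom, CC_natCast_mul, CC_neg,
    sub_eq_add_neg]

lemma shiftRF_sub (N : ℕ) (ℏ : ℂ) {t b : Fin ℓ} (hb : b ≠ t) :
    shiftRF t (-((N : ℂ) * ℏ)) (XX b - XX t) = XX b - XX t + (N : RF ℓ) * CC ℏ := by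
  rw [map_sub, shiftRF_XX, shiftRF_XX, if_neg hb, if_pos rfl, CC_neg, CC_natCast_mul]
  ring

lemma shiftRF_eProdOff (ℏ c : ℂ) (u : Fin ℓ → ℕ) (t : Fin ℓ) :
    shiftRF t c (eProdOff ℏ u t) = eProdOff ℏ u t := by
  unfold eProdOff
  rw [map_prod]
  refine Finset.prod_congr rfl fun ab _ => ?_
  split_ifs with h
  · rw [map_inv₀, map_sub, map_sub, shiftRF_XX, shiftRF_XX, shiftRF_CC, if_neg h.2.2.1,
      if_neg h.2.2.2]
  · exact map_one _

lemma shiftRF_movedProd (N : ℕ) (ℏ : ℂ) (u : Fin ℓ → ℕ) {t : Fin ℓ} (ht : (t : ℕ) = ℓ - 1)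
    {B : Finset (Fin ℓ)} (hB : t ∉ B) (c q : ℤ) :
    shiftRF t (-((N : ℂ) * ℏ)) (movedProd ℏ u t B c q) =
      (c : RF ℓ) * (eProdOff ℏ u t *
        ∏ b ∈ univ.erase t, (XX b - XX t + CC (((N : ℂ) - 1) * ℏ))⁻¹) *
        ∏ b ∈ B, (XX b - XX t - ((q - N : ℤ) : RF ℓ) * CC ℏ) := by
  rw [movedProd, map_mul, map_mul, map_mul, map_intCast, shiftRF_eProdOff, map_prod, map_prod]
  congr 1
  · congr 2
    refine Finset.prod_congr rfl fun b hb => ?_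
    have hb' := (Finset.mem_erase.1 hb).1
    have hlt : b < t := by
      have := b.isLt
      rw [ne_eq, Fin.ext_iff] at hb'
      rw [Fin.lt_def]
      omega
    rw [pairFactor, if_pos hlt, map_inv₀, map_sub, shiftRF_sub N ℏ hb', shiftRF_CC,
      CC_sub_one_mul, add_sub_assoc]
  · refine Finset.prod_congr rfl fun b hb => ?_
    have hb' : b ≠ t := fun h => hB (h ▸ hb)
    rw [map_sub, shiftRF_sub N ℏ hb', map_mul, map_intCast, shiftRF_CC]
    push_cast
    ring

lemma permRF_finRotate_symm_eProdOff (ℏ : ℂ) (u : Fin ℓ → ℕ) {s t : Fin ℓ} (hs : (s : ℕ) = 0)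
    (ht : (t : ℕ) = ℓ - 1) :
    permRF (finRotate ℓ).symm (eProdOff ℏ (u ∘ (finRotate ℓ).symm) s) = eProdOff ℏ u t := by
  unfold eProdOff
  rw [map_prod]
  refine Fintype.prod_equiv (Equiv.prodCongr (finRotate ℓ).symm (finRotate ℓ).symm) _ _
    fun ab => ?_
  obtain ⟨a, b⟩ := ab
  have h1 : ∀ x, (finRotate ℓ).symm x ≠ t ↔ x ≠ s := by
    intro x
    have := x.isLt
    rw [ne_eq, ne_eq, Fin.ext_iff, Fin.ext_iff, val_finRotate_symm]
    split_ifs <;> omega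
  have h2 : a ≠ s → b ≠ s → ((finRotate ℓ).symm a < (finRotate ℓ).symm b ↔ a < b) := by
    intro ha hb
    rw [ne_eq, Fin.ext_iff] at ha hb
    rw [Fin.lt_def, Fin.lt_def, val_finRotate_symm, val_finRotate_symm, if_neg (by omega),
      if_neg (by omega)]
    omega
  simp only [Equiv.prodCongr_apply, Prod.map_apply, Function.comp_apply, h1]
  by_cases ha : a = s
  · simp [ha]
  by_cases hb : b = s
  · simp [hb]
  simp only [h2 ha hb]
  split_ifs <;> simp

lemma permRF_finRotate_symm_movedProd (ℏ : ℂ) (u : Fin ℓ → ℕ) {s t : Fin ℓ} (hs : (s : ℕ) = 0)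
    (ht : (t : ℕ) = ℓ - 1) {B B' : Finset (Fin ℓ)}
    (hB : ∀ b, b ∈ B ↔ (finRotate ℓ).symm b ∈ B') (c q : ℤ) :
    permRF (finRotate ℓ).symm (movedProd ℏ (u ∘ (finRotate ℓ).symm) s B c q) =
      (c : RF ℓ) * (eProdOff ℏ u t *
        ∏ b ∈ univ.erase t, ((-1) * (XX b - XX t + CC ℏ)⁻¹)) *
        ∏ b ∈ B', (XX b - XX t - (q : RF ℓ) * CC ℏ) := by
  have hst : ∀ x, x = s ↔ (finRotate ℓ).symm x = t := by
    intro x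
    have := x.isLt
    rw [Fin.ext_iff, Fin.ext_iff, val_finRotate_symm]
    split_ifs <;> omega
  have hst' := (hst s).1 rfl
  rw [movedProd, map_mul, map_mul, map_mul, map_intCast,
    permRF_finRotate_symm_eProdOff ℏ u hs ht, map_prod, map_prod]
  congr 1
  · congr 2
    refine Finset.prod_equiv (finRotate ℓ).symm (fun b => ?_) fun b hb => ?_
    · simp [hst]
    · have hb' := (Finset.mem_erase.1 hb).1
      rw [ne_eq, Fin.ext_iff, hs] at hb'
      rw [pairFactor, if_neg (by rw [Fin.lt_def]; omega), map_inv₀, map_sub, map_sub, permRF_XX,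
        permRF_XX, permRF_CC, hst', neg_one_mul, ← inv_neg]
      congr 1
      ring
  · refine Finset.prod_equiv (finRotate ℓ).symm hB fun b _ => ?_
    simp [hst']

lemma shiftRel_insTuple {ℏ : ℂ} (hℏ : ℏ ≠ 0) {n m k : ℕ} (hm : 0 < m) (hk : k ≤ n)
    (hℓ : ℓ = (n + 1) * m) {t : Fin ℓ} (ht : (t : ℕ) = ℓ - 1) :
    ShiftRel (n + 2) ℏ t (insTuple ℓ (delSeq m k) k t) := by
  obtain ⟨i, rfl⟩ := Nat.exists_eq_add_of_le hk
  have hℓ' : ℓ = (k + i) * m + m := by rw [hℓ]; ring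
  have hkm : k * m ≤ (k + i) * m := Nat.mul_le_mul_right m hk
  set s : Fin ℓ := ⟨0, by omega⟩ with hs
  have hR := hFun_insTuple_right hℏ hm k i t (by omega)
  have hL := hFun_insTuple_left hℏ hm k k 0 s (by omega) (by simp [hs]) (by omega)
  have hu := insTuple_comp_finRotate_symm (delSeq m k) k ht
  have hs0 : (s : ℕ) = 0 := rfl
  rw [hs0, ← hu] at hL
  rw [ShiftRel, hR, hL, shiftRF_movedProd _ ℏ _ ht,
    permRF_finRotate_symm_movedProd ℏ _ hs0 ht (B' := posIco ℓ (k * m) (k * m + m - 1))]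
  · have hq : (1 + (i : ℤ)) - ((k + i + 2 : ℕ) : ℤ) = -1 - k := by push_cast; ring
    rw [hq]
    have hz : ∀ b ∈ univ.erase t, (XX b - XX t + CC ℏ) /
        (XX b - XX t + CC ((((k + i + 2 : ℕ) : ℂ) - 1) * ℏ)) * ((-1) * (XX b - XX t + CC ℏ)⁻¹) =
        (-1 : RF ℓ) * (XX b - XX t + CC ((((k + i + 2 : ℕ) : ℂ) - 1) * ℏ))⁻¹ := by
      intro b _
      have := XX_sub_XX_add_CC_ne_zero' hℏ b t
      generalize (XX b - XX t + CC ((((k + i + 2 : ℕ) : ℂ) - 1) * ℏ) : RF ℓ) = y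
      generalize (XX b - XX t + CC ℏ : RF ℓ) = x at this ⊢
      rw [div_mul_eq_mul_div, mul_left_comm, mul_inv_cancel₀ this, mul_one, div_eq_mul_inv]
    have key : (∏ b ∈ univ.erase t, (XX b - XX t + CC ℏ) /
        (XX b - XX t + CC ((((k + i + 2 : ℕ) : ℂ) - 1) * ℏ))) *
        ∏ b ∈ univ.erase t, ((-1) * (XX b - XX t + CC ℏ)⁻¹) = (-1 : RF ℓ) ^ (ℓ - 1) *
        ∏ b ∈ univ.erase t, (XX b - XX t + CC ((((k + i + 2 : ℕ) : ℂ) - 1) * ℏ))⁻¹ := by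
      rw [← Finset.prod_mul_distrib, Finset.prod_congr rfl hz, Finset.prod_mul_distrib,
        Finset.prod_const, Finset.card_erase_of_mem (mem_univ t), Finset.card_univ,
        Fintype.card_fin]
    have hsign : (((-1) ^ (m * i) : ℤ) : RF ℓ) =
        (((-1) ^ (m - 1 + m * k) : ℤ) : RF ℓ) * (-1) ^ (ℓ - 1) := by
      have h1 : (m - 1 + m * k) + (ℓ - 1) = m * i + 2 * (m - 1 + m * k) := by
        have : (k + i) * m = m * k + m * i := by ring
        omega
      push_cast
      rw [← pow_add, h1, pow_add, pow_mul (-1 : RF ℓ) 2]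
      simp
    rw [hsign]
    revert key
    generalize ∏ b ∈ univ.erase t, (XX b - XX t + CC ℏ) / (_ : RF ℓ) = x
    generalize ∏ b ∈ univ.erase t, ((-1) * (XX b - XX t + CC ℏ)⁻¹ : RF ℓ) = y
    generalize ∏ b ∈ univ.erase t, (XX b - XX t + CC ((((k + i + 2 : ℕ) : ℂ) - 1) * ℏ) : RF ℓ)⁻¹ = d
    generalize eProdOff ℏ (insTuple ℓ (delSeq m k) k t) t = e
    generalize (((-1) ^ (m - 1 + m * k) : ℤ) : RF ℓ) = g
    generalize ∏ b ∈ posIco ℓ (k * m) (k * m + m - 1), (_ : RF ℓ) = z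
    generalize (-1 : RF ℓ) ^ (ℓ - 1) = r
    intro key
    linear_combination (-(g * e * z)) * key
  · intro b
    have := b.isLt
    rw [mem_posIco, mem_posIco, val_finRotate_symm]
    split_ifs <;> omega
  · rw [mem_posIco]
    omega

lemma shiftRel_comp_swap {N : ℕ} {ℏ : ℂ} {t : Fin ℓ} (ht : (t : ℕ) = ℓ - 1) {u : Fin ℓ → ℕ}
    (hu : ShiftRel N ℏ t u) {p q : Fin ℓ} (hpq : (q : ℕ) = p + 1) (hq : q ≠ t) :
    ShiftRel N ℏ t (u ∘ Equiv.swap p q) := by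
  have hqt : (q : ℕ) < ℓ - 1 := by
    have := q.isLt
    rw [ne_eq, Fin.ext_iff] at hq
    omega
  have hp : p ≠ t := by rw [ne_eq, Fin.ext_iff]; omega
  obtain ⟨p', hp'⟩ := (finRotate ℓ).symm.surjective p
  obtain ⟨q', hq'⟩ := (finRotate ℓ).symm.surjective q
  have hp2 := congrArg Fin.val hp'
  have hq2 := congrArg Fin.val hq'
  rw [val_finRotate_symm] at hp2 hq2
  have hpq' : (q' : ℕ) = p' + 1 := by
    have := p'.isLt
    have := q'.isLt
    split_ifs at hp2 hq2 <;> omega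
  have hcomp : (u ∘ Equiv.swap p q) ∘ (finRotate ℓ).symm =
      (u ∘ (finRotate ℓ).symm) ∘ Equiv.swap p' q' := by
    funext x
    simp only [Function.comp_apply]
    rw [← hp', ← hq', (finRotate ℓ).symm.injective.map_swap]
  have hst : ∀ x, Equiv.swap p q x = t ↔ x = t := by
    intro x
    rw [← Equiv.eq_symm_apply, Equiv.symm_swap,
      Equiv.swap_apply_of_ne_of_ne hp.symm hq.symm]
  rw [ShiftRel, hcomp, hFun_comp_swap ℏ _ hpq, hFun_comp_swap ℏ _ hpq', shiftRF_exch ℏ _ hp hq,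
    permRF_exch, hp', hq', hu, exch_mul]
  rw [map_prod]
  refine Finset.prod_equiv (Equiv.swap p q) (fun b => by simp [hst]) fun b _ => ?_
  simp [(hst t).2 rfl]

end Rotation

section Counting

variable {ℓ : ℕ}

lemma le_iff_of_monotone_lt {u : Fin ℓ → ℕ} {n : ℕ} (hn : n ≤ ℓ)
    (hu : ∀ p q : Fin ℓ, (q : ℕ) = p + 1 → (q : ℕ) < n → u p ≤ u q) {a : Fin ℓ}
    (ha : (a : ℕ) < n) (j : ℕ) :
    j ≤ u a ↔ n ≤ a + (univ.filter fun b : Fin ℓ => (b : ℕ) < n ∧ j ≤ u b).card := by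
  have hmono : ∀ d : ℕ, ∀ b c : Fin ℓ, (c : ℕ) = b + d → (c : ℕ) < n → u b ≤ u c := by
    intro d
    induction d with
    | zero =>
      intro b c hbc _
      rw [Fin.ext hbc]
    | succ d ih =>
      intro b c hbc hc
      have hlt := c.isLt
      exact (ih b ⟨b + d, by omega⟩ rfl (by simp; omega)).trans
        (hu _ c (by simp only; omega) hc)
  constructor
  · intro h
    have h1 : posIco ℓ a n ⊆ univ.filter fun b : Fin ℓ => (b : ℕ) < n ∧ j ≤ u b := by
      intro b hb
      have hb' := mem_posIco.1 hb
      exact Finset.mem_filter.2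
        ⟨mem_univ _, hb'.2, h.trans (hmono (b - a) a b (by omega) hb'.2)⟩
    have h2 := Finset.card_le_card h1
    rw [card_posIco hn] at h2
    omega
  · intro h
    by_contra hlt
    have h1 : (univ.filter fun b : Fin ℓ => (b : ℕ) < n ∧ j ≤ u b) ⊆ posIco ℓ (a + 1) n := by
      intro b hb
      have hb' := (Finset.mem_filter.1 hb).2
      refine mem_posIco.2 ⟨?_, hb'.1⟩
      by_contra hab
      have := hmono (a - b) b a (by omega) ha
      omega
    have h2 := Finset.card_le_card h1
    rw [card_posIco hn] at h2
    omega

lemma sub_mul_add_mul {n m j : ℕ} (hj : j ≤ n) (hℓ : ℓ = (n + 1) * m) :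
    (n + 2 - 1 - j) * m + j * m = ℓ := by
  rw [hℓ, ← add_mul]
  congr 1
  omega

lemma eq_of_forall_le_iff_of_le {a b n : ℕ} (ha : a ≤ n) (hb : b ≤ n)
    (h : ∀ j, 1 ≤ j → j ≤ n → (j ≤ a ↔ j ≤ b)) : a = b := by
  rcases lt_trichotomy a b with hab | hab | hab
  · have := (h b (by omega) hb).2 le_rfl
    omega
  · exact hab
  · have := (h a (by omega) ha).1 le_rfl
    omega

lemma IsIdx.eq_div {n m : ℕ} (hm : 0 < m) (hℓ : ℓ = (n + 1) * m) {u : Fin ℓ → ℕ}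
    (hu : IsIdx (n + 2) m ℓ u) (hmono : ∀ p q : Fin ℓ, (q : ℕ) = p + 1 → u p ≤ u q) :
    u = fun a : Fin ℓ => (a : ℕ) / m := by
  funext a
  have ha := a.isLt
  refine eq_of_forall_le_iff_of_le (hu.1 a) (n := n) ?_ fun j h1 h2 => ?_
  · rw [← Nat.lt_add_one_iff, Nat.div_lt_iff_lt_mul hm]
    omega
  · have hc := hu.2 j h1 h2
    have := sub_mul_add_mul h2 hℓ
    rw [le_iff_of_monotone_lt le_rfl (fun p q h _ => hmono p q h) ha, Nat.le_div_iff_mul_le hm]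
    simp only [Fin.is_lt, true_and, hc]
    omega

lemma IsIdx.eq_insTuple {n m : ℕ} (hm : 0 < m) (hℓ : ℓ = (n + 1) * m) {u : Fin ℓ → ℕ}
    (hu : IsIdx (n + 2) m ℓ u) {t : Fin ℓ} (ht : (t : ℕ) = ℓ - 1)
    (hmono : ∀ p q : Fin ℓ, (q : ℕ) = p + 1 → q ≠ t → u p ≤ u q) :
    u = insTuple ℓ (delSeq m (u t)) (u t) t := by
  funext a
  have ha := a.isLt
  by_cases hat : a = t
  · simp [hat, insTuple]
  have hat' : (a : ℕ) < ℓ - 1 := by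
    rw [Fin.ext_iff] at hat
    omega
  rw [insTuple, if_pos (by omega)]
  have hℓ' : ℓ = n * m + m := by rw [hℓ]; ring
  refine eq_of_forall_le_iff_of_le (hu.1 a) (n := n) ?_ fun j h1 h2 => ?_
  · unfold delSeq
    split_ifs <;> rw [← Nat.lt_add_one_iff, Nat.div_lt_iff_lt_mul hm] <;> omega
  · have hc := hu.2 j h1 h2
    have hj := sub_mul_add_mul h2 hℓ
    have he : (univ.filter fun b : Fin ℓ => (b : ℕ) < ℓ - 1 ∧ j ≤ u b) =
        (univ.filter fun b : Fin ℓ => j ≤ u b).erase t := by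
      ext b
      have hb := b.isLt
      simp only [Finset.mem_filter, mem_univ, true_and, Finset.mem_erase, ne_eq, Fin.ext_iff]
      omega
    rw [le_iff_of_monotone_lt (Nat.sub_le ℓ 1)
      (fun p q h hq => hmono p q h (by rw [ne_eq, Fin.ext_iff]; omega)) hat', he,
      Finset.card_erase_eq_ite, hc]
    simp only [Finset.mem_filter, mem_univ, true_and]
    have hm1 : 1 * m ≤ (n + 2 - 1 - j) * m := Nat.mul_le_mul_right m (by omega)
    unfold delSeq
    rcases le_or_gt j (u t) with hjt | hjt
    · have := Nat.mul_le_mul_right m hjt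
      rw [if_pos hjt]
      split_ifs <;> rw [Nat.le_div_iff_mul_le hm] <;> omega
    · have := Nat.mul_le_mul_right m (Nat.succ_le_of_lt hjt)
      rw [Nat.succ_mul] at this
      rw [if_neg (by omega)]
      split_ifs <;> rw [Nat.le_div_iff_mul_le hm] <;> omega

lemma IsIdx.comp_perm {N m : ℕ} {u : Fin ℓ → ℕ} (hu : IsIdx N m ℓ u) (σ : Equiv.Perm (Fin ℓ)) :
    IsIdx N m ℓ (u ∘ σ) := by
  refine ⟨fun a => hu.1 _, fun j h1 h2 => ?_⟩
  rw [← hu.2 j h1 h2]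
  exact Finset.card_equiv σ fun a => by simp

lemma comp_swap_comp_swap (u : Fin ℓ → ℕ) (p q : Fin ℓ) :
    (u ∘ Equiv.swap p q) ∘ Equiv.swap p q = u := by
  funext x
  simp

lemma shiftRel_of_isIdx {ℏ : ℂ} (hℏ : ℏ ≠ 0) {n m : ℕ} (hm : 0 < m) (hℓ : ℓ = (n + 1) * m)
    {t : Fin ℓ} (ht : (t : ℕ) = ℓ - 1) (u : Fin ℓ → ℕ) (hu : IsIdx (n + 2) m ℓ u) :
    ShiftRel (n + 2) ℏ t u := by
  induction h : disorder u using Nat.strong_induction_on generalizing u with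
  | _ d ih =>
  by_cases hd : ∀ p q : Fin ℓ, (q : ℕ) = p + 1 → q ≠ t → u p ≤ u q
  · rw [hu.eq_insTuple hm hℓ ht hd]
    exact shiftRel_insTuple hℏ hm (hu.1 t) hℓ ht
  · push Not at hd
    obtain ⟨p, q, hpq, hqt, hlt⟩ := hd
    have := shiftRel_comp_swap ht
      (ih _ (h ▸ disorder_swap_lt hpq hlt) _ (hu.comp_perm _) rfl) hpq hqt
    rwa [comp_swap_comp_swap] at this

end Counting

lemma exchange_eq_iff {K : Type*} [Field K] {x h s y z : K} (hx : x ≠ 0) (hxh : x + h ≠ 0) :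
    s = x / (x + h) * z + h / (x + h) * y ↔ z = ((x + h) * s - h * y) / x := by
  rw [eq_div_iff hx, div_mul_eq_mul_div, div_mul_eq_mul_div, ← add_div, eq_div_iff hxh]
  constructor <;> intro h <;> linear_combination -h

lemma hRel1_iff {N m ℓ : ℕ} {ℏ : ℂ} {H : IdxT N m ℓ → RF ℓ} :
    HRel1 N m ℓ ℏ H ↔ ∀ (ε ε' : IdxT N m ℓ) (p q : Fin ℓ), (q : ℕ) = (p : ℕ) + 1 →
      ε'.1 = ε.1 ∘ Equiv.swap p q → H ε = exch ℏ p q (H ε') := by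
  have hne : ∀ p q : Fin ℓ, (q : ℕ) = (p : ℕ) + 1 → p ≠ q := fun p q h => by
    rw [ne_eq, Fin.ext_iff]
    omega
  unfold HRel1 exch
  refine forall₄_congr fun ε ε' p q => forall₂_congr fun hpq _ => ?_
  exact exchange_eq_iff (XX_sub_XX_ne_zero (hne p q hpq))
    (XX_sub_XX_add_CC_ne_zero (hne p q hpq) ℏ)

lemma hRel1_hFun (N m ℓ : ℕ) (ℏ : ℂ) :
    HRel1 N m ℓ ℏ fun ε : IdxT N m ℓ => hFun ℏ ε.1 := by
  rw [hRel1_iff]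
  intro ε ε' p q hpq hε
  rw [← hFun_comp_swap ℏ _ hpq, hε, comp_swap_comp_swap]

lemma hRel3_hFun (N m ℓ : ℕ) (ℏ : ℂ) :
    HRel3 N m ℓ ℏ fun ε : IdxT N m ℓ => hFun ℏ ε.1 := by
  intro ε hε
  simp only [hε]
  rw [hFun_eq_eProd ℏ fun p q hpq => Nat.div_le_div_right (by omega), eProd,
    Finset.prod_filter]
  refine Finset.prod_congr rfl fun ab _ => if_congr ?_ rfl rfl
  rw [Fin.lt_def]
  constructor
  · rintro ⟨h1, h2⟩
    exact lt_of_le_of_ne (Nat.div_le_div_right h1.le) h2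
  · intro h
    refine ⟨?_, h.ne⟩
    by_contra hle
    exact absurd (Nat.div_le_div_right (c := m) (not_lt.1 hle)) (not_le.2 h)

lemma eq_hFun_of_hRel {n m ℓ : ℕ} (hm : 0 < m) (hℓ : ℓ = (n + 1) * m) {ℏ : ℂ}
    {H : IdxT (n + 2) m ℓ → RF ℓ} (h1 : HRel1 (n + 2) m ℓ ℏ H) (h3 : HRel3 (n + 2) m ℓ ℏ H)
    (ε : IdxT (n + 2) m ℓ) : H ε = hFun ℏ ε.1 := by
  induction h : disorder ε.1 using Nat.strong_induction_on generalizing ε with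
  | _ d ih =>
  by_cases hd : ∀ p q : Fin ℓ, (q : ℕ) = p + 1 → ε.1 p ≤ ε.1 q
  · have hε := ε.2.eq_div hm hℓ hd
    rw [h3 ε hε, ← hRel3_hFun (n + 2) m ℓ ℏ ε hε]
  · push Not at hd
    obtain ⟨p, q, hpq, hlt⟩ := hd
    let ε' : IdxT (n + 2) m ℓ := ⟨ε.1 ∘ Equiv.swap p q, ε.2.comp_perm _⟩
    rw [hRel1_iff.1 h1 ε ε' p q hpq rfl, ih _ (h ▸ disorder_swap_lt hpq hlt) ε' rfl,
      ← hFun_comp_swap ℏ _ hpq, comp_swap_comp_swap]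

/-- existence and uniqueness of the family `{H_{ε₁,…,ε_ℓ}}` of rational
functions in `ℓ = (N−1)m` variables satisfying the exchange relation (i), the shift
relation (ii) and the normalization (iii). -/
theorem statement0 (N m : ℕ) (hN : 2 ≤ N) (hm : 1 ≤ m) (ℏ : ℂ) (hℏ : ℏ ≠ 0) :
    ∃! H : IdxT N m ((N - 1) * m) → RF ((N - 1) * m),
      HRel1 N m ((N - 1) * m) ℏ H ∧ HRel2 N m ((N - 1) * m) ℏ H ∧
        HRel3 N m ((N - 1) * m) ℏ H := by
  obtain ⟨n, rfl⟩ := Nat.exists_eq_add_of_le' hN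
  refine ⟨fun ε => hFun ℏ ε.1, ⟨hRel1_hFun _ _ _ ℏ, ?_, hRel3_hFun _ _ _ ℏ⟩, ?_⟩
  · intro ε ε' t ht hε
    beta_reduce
    rw [hε]
    exact shiftRel_of_isIdx hℏ hm rfl ht ε.1 ε.2
  · rintro H ⟨h1, -, h3⟩
    funext ε
    exact eq_hFun_of_hRel hm rfl h1 h3 ε

end
end

section
/- Let ℏ be a nonzero complex number and let n ≥ ν₁ ≥ ν₂ ≥ 0 be integers. For J ∈ Z_{ν₁,ν₂} (n-tuples with entries in {0,1,2} with #{r : J_r ≥ 1} = ν₁ and #{r : J_r ≥ 2} = ν₂) define w^{(3)}_J(γ₁,…,γ_{ν₂}; α₁,…,α_{ν₁} | β₁,…,β_n) := Skew_{γ₁,…,γ_{ν₂}} Skew_{α₁,…,α_{ν₁}} ( g_{M₁^J}(α₁,…,α_{ν₁} | β₁,…,β_n) · g_{M₂^J}(γ₁,…,γ_{ν₂} | α₁,…,α_{ν₁}) ). Then for every J' ∈ Z_{ν₁−1,ν₂}, the following identity of rational functions holds: ℏ · Σ_{j: J'_j = 0} w^{(3)}_{(J'₁,…,J'_j+1,…,J'_n)}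 = Skew_{γ₁,…,γ_{ν₂}} Skew_{α₁,…,α_{ν₁}} ( g_{M₁^{J'}}(α₂,…,α_{ν₁} | β₁,…,β_n) · g_{M₂^{J'}}(γ₁,…,γ_{ν₂} | α₂,…,α_{ν₁}) · [ ∏_{a=2}^{ν₁}(α₁−α_a−ℏ) · ∏_{m=1}^{ν₂}(γ_m−α₁−ℏ)/(γ_m−α₁) − ∏_{j=1}^{n}(α₁−β_j−ℏ)/(α₁−β_j) · ∏_{a=2}^{ν₁}(α₁−α_a+ℏ) ] ). -/
open Finset

noncomputable section

/-- The function `g_K(t₁,…,t_l | z₁,…,z_{m'})` of Section 3, where the subset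
`K = {k₁ < ⋯ < k_l}` is encoded by its increasing enumeration `e : Fin l → Fin m'`:
`g_K = ∏_a [1/(t_a−z_{k_a}) ∏_{j<k_a}(t_a−z_j−ℏ)/(t_a−z_j)] ∏_{a<b}(t_a−t_b−ℏ)`. -/
def gfun {l m' : ℕ} (ℏ : ℂ) (e : Fin l → Fin m') (t : Fin l → ℂ) (z : Fin m' → ℂ) : ℂ :=
  (∏ a : Fin l,
    ((t a - z (e a))⁻¹ *
      ∏ j ∈ Finset.univ.filter fun j => j < e a, (t a - z j - ℏ) / (t a - z j))) *
    ∏ ab ∈ Finset.univ.filter fun ab : Fin l × Fin l => ab.1 < ab.2,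
      (t ab.1 - t ab.2 - ℏ)

/-- `e` is the increasing enumeration of the set `s`. -/
def EnumOf {k n : ℕ} (e : Fin k → Fin n) (s : Set (Fin n)) : Prop :=
  StrictMono e ∧ ∀ r, r ∈ s ↔ ∃ a, e a = r

/-- The doubly skew-symmetrized function
`w^{(3)}_J(γ;α|β) = Skew_γ Skew_α ( g_{M₁^J}(α|β) · g_{M₂^J}(γ|α) )`, where the sets
`M₁^J ⊆ {1,…,n}` and `M₂^J ⊆ {1,…,ν₁}` are given through their increasing
enumerations `e1`, `e2`. -/
def w3 {n ν₁ ν₂ : ℕ} (ℏ : ℂ) (e1 : Fin ν₁ → Fin n) (e2 : Fin ν₂ → Fin ν₁)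
    (α : Fin ν₁ → ℂ) (γ : Fin ν₂ → ℂ) (β : Fin n → ℂ) : ℂ :=
  ∑ τ : Equiv.Perm (Fin ν₂), ∑ σ : Equiv.Perm (Fin ν₁),
    ((Equiv.Perm.sign τ : ℤ) : ℂ) * ((Equiv.Perm.sign σ : ℤ) : ℂ) *
      (gfun ℏ e1 (α ∘ σ) β * gfun ℏ e2 (γ ∘ τ) (α ∘ σ))

/-- The product of `(x - z i - ℏ) / (x - z i)` over the indices `i < j`. -/
def ratioProd {n : ℕ} (ℏ : ℂ) (z : Fin n → ℂ) (j : ℕ) (x : ℂ) : ℂ :=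
  ∏ i : Fin n, if (i : ℕ) < j then (x - z i - ℏ) / (x - z i) else 1

/-- The product of `x - t a ± ℏ`, with sign `+` exactly when `e a < j`. -/
def crossProd {p n : ℕ} (ℏ : ℂ) (e : Fin p → Fin n) (j : ℕ) (x : ℂ) (t : Fin p → ℂ) : ℂ :=
  ∏ a, if (e a : ℕ) < j then x - t a + ℏ else x - t a - ℏ

/-- The product of `(γ c - x - ℏ) / (γ c - x)` over the indices `c` with `j ≤ e c`. -/
def upperProd {q n : ℕ} (ℏ : ℂ) (e : Fin q → Fin n) (j : ℕ) (γ : Fin q → ℂ) (x : ℂ) : ℂ :=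
  ∏ c, if (e c : ℕ) < j then 1 else (γ c - x - ℏ) / (γ c - x)

lemma gfun_eq {l m : ℕ} (ℏ : ℂ) (e : Fin l → Fin m) (t : Fin l → ℂ) (z : Fin m → ℂ) :
    gfun ℏ e t z = (∏ a, ((t a - z (e a))⁻¹ * ratioProd ℏ z (e a) (t a))) *
      ∏ a, ∏ b, if a < b then t a - t b - ℏ else 1 := by
  simp only [gfun, ratioProd, Finset.prod_filter, Fintype.prod_prod_type, Fin.lt_def]

lemma ratioProd_succ {n : ℕ} (ℏ : ℂ) (z : Fin n → ℂ) (j : Fin n) (x : ℂ) :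
    ratioProd ℏ z (j + 1) x = ratioProd ℏ z j x * ((x - z j - ℏ) / (x - z j)) := by
  have h : (x - z j - ℏ) / (x - z j) =
      ∏ i : Fin n, if i = j then (x - z i - ℏ) / (x - z i) else 1 := by simp
  rw [h, ratioProd, ratioProd, ← Finset.prod_mul_distrib]
  refine Finset.prod_congr rfl fun i _ => ?_
  rcases lt_trichotomy i j with h | h | h
  · have h' : (i : ℕ) < j := h
    simp [h', h.ne, Nat.lt_succ_of_lt h']
  · simp [h]
  · have h' : (j : ℕ) < i := h
    simp [h.ne', h'.not_gt, show ¬ (i : ℕ) < j + 1 by omega]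

/-- Splitting off the index `s` from `g`: the factors involving `α s`. -/
lemma gfun_succAbove {p n : ℕ} (ℏ : ℂ) (E : Fin (p + 1) → Fin n) (hE : StrictMono E)
    (s : Fin (p + 1)) (α : Fin (p + 1) → ℂ) (β : Fin n → ℂ) :
    gfun ℏ E α β = gfun ℏ (E ∘ s.succAbove) (α ∘ s.succAbove) β *
      ((α s - β (E s))⁻¹ * ratioProd ℏ β (E s) (α s)) *
      ((∏ a, if s.succAbove a < s then (-1 : ℂ) else 1) *
        crossProd ℏ (E ∘ s.succAbove) (E s) (α s) (α ∘ s.succAbove)) := by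
  have key : ((∏ a, if s.succAbove a < s then (-1 : ℂ) else 1) *
        crossProd ℏ (E ∘ s.succAbove) (E s) (α s) (α ∘ s.succAbove)) =
      (∏ b, if s < s.succAbove b then α s - α (s.succAbove b) - ℏ else 1) *
      (∏ a, if s.succAbove a < s then α (s.succAbove a) - α s - ℏ else 1) := by
    rw [crossProd, ← Finset.prod_mul_distrib, ← Finset.prod_mul_distrib]
    refine Finset.prod_congr rfl fun a _ => ?_
    have hiff : (E (s.succAbove a) : ℕ) < E s ↔ s.succAbove a < s := hE.lt_iff_lt
    rcases lt_or_gt_of_ne (s.succAbove_ne a) with h | h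
    · simp only [Function.comp, hiff, h, h.not_gt, if_true, if_false]
      ring
    · simp only [Function.comp, hiff, h, h.not_gt, if_true, if_false]
      ring
  rw [key, gfun_eq, gfun_eq, Fin.prod_univ_succAbove _ s, Fin.prod_univ_succAbove _ s,
    Fin.prod_univ_succAbove _ s]
  simp only [Fin.prod_univ_succAbove _ s, lt_self_iff_false, if_false, one_mul,
    Finset.prod_mul_distrib, Fin.succAbove_lt_succAbove_iff, Function.comp]
  ring

/-- Inserting a variable `α s` not singled out by `e` into the second group of variables. -/
lemma gfun_comp_succAbove {p q n : ℕ} (ℏ : ℂ) (e : Fin q → Fin p) (E : Fin (p + 1) → Fin n)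
    (hE : StrictMono E) (s : Fin (p + 1)) (γ : Fin q → ℂ) (α : Fin (p + 1) → ℂ) :
    gfun ℏ (s.succAbove ∘ e) γ α = gfun ℏ e γ (α ∘ s.succAbove) *
      upperProd ℏ (E ∘ s.succAbove ∘ e) (E s) γ (α s) := by
  rw [gfun_eq, gfun_eq, upperProd, mul_right_comm]
  congr 1
  rw [← Finset.prod_mul_distrib]
  refine Finset.prod_congr rfl fun c _ => ?_
  simp only [ratioProd, Function.comp]
  rw [Fin.prod_univ_succAbove _ s]
  simp only [← Fin.lt_def, Fin.succAbove_lt_succAbove_iff, hE.lt_iff_lt]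
  rcases lt_or_gt_of_ne (s.succAbove_ne (e c)) with h | h
  · simp [h, h.not_gt]
  · simp only [h, h.not_gt, if_true, if_false]
    ring

lemma prod_neg_one_succAbove {p : ℕ} (s : Fin (p + 1)) :
    (∏ a, if s.succAbove a < s then (-1 : ℂ) else 1) = (-1) ^ (s : ℕ) := by
  rw [← Finset.prod_filter, Finset.prod_const]
  congr 1
  have h : (Finset.univ.filter fun a : Fin p => s.succAbove a < s) =
      Finset.univ.filter fun a : Fin p => (a : ℕ) < s := by
    ext a
    rw [Finset.mem_filter, Finset.mem_filter, Fin.succAbove_lt_iff_castSucc_lt, Fin.lt_def]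
    rfl
  rw [h, Fin.card_filter_val_lt]
  have := s.isLt
  omega

/-- The skew-symmetrization of `F` over the variables `α`. -/
def skewSum {p : ℕ} (F : (Fin p → ℂ) → ℂ) (α : Fin p → ℂ) : ℂ :=
  ∑ σ : Equiv.Perm (Fin p), ((Equiv.Perm.sign σ : ℤ) : ℂ) * F (α ∘ σ)

lemma skewSum_comp {p : ℕ} (F : (Fin p → ℂ) → ℂ) (ρ : Equiv.Perm (Fin p)) (α : Fin p → ℂ) :
    skewSum F α = ((Equiv.Perm.sign ρ : ℤ) : ℂ) * skewSum (fun t => F (t ∘ ρ)) α := by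
  rw [skewSum, skewSum, ← Equiv.sum_comp (Equiv.mulRight ρ), Finset.mul_sum]
  refine Finset.sum_congr rfl fun σ _ => ?_
  simp only [Equiv.coe_mulRight, Equiv.Perm.sign_mul, Units.val_mul, Int.cast_mul,
    Equiv.Perm.coe_mul, Function.comp_assoc]
  ring

/-- Function whose consecutive differences give the summands of the identity. -/
def telescope {p q n : ℕ} (ℏ : ℂ) (e₁ : Fin p → Fin n) (e₂ : Fin q → Fin p) (γ : Fin q → ℂ)
    (β : Fin n → ℂ) (j : ℕ) (x : ℂ) (t : Fin p → ℂ) : ℂ :=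
  ratioProd ℏ β j x * crossProd ℏ e₁ j x t * upperProd ℏ (e₁ ∘ e₂) j γ x

lemma crossProd_succ {p n : ℕ} (ℏ : ℂ) (e : Fin p → Fin n) (j : ℕ) (hj : ∀ a, (e a : ℕ) ≠ j)
    (x : ℂ) (t : Fin p → ℂ) : crossProd ℏ e (j + 1) x t = crossProd ℏ e j x t := by
  refine Finset.prod_congr rfl fun a _ => ?_
  have := hj a
  simp only [show (e a : ℕ) < j + 1 ↔ (e a : ℕ) < j by omega]

lemma upperProd_succ {q n : ℕ} (ℏ : ℂ) (e : Fin q → Fin n) (j : ℕ) (hj : ∀ a, (e a : ℕ) ≠ j)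
    (γ : Fin q → ℂ) (x : ℂ) : upperProd ℏ e (j + 1) γ x = upperProd ℏ e j γ x := by
  refine Finset.prod_congr rfl fun a _ => ?_
  have := hj a
  simp only [show (e a : ℕ) < j + 1 ↔ (e a : ℕ) < j by omega]

lemma telescope_sub_of_notMem {p q n : ℕ} (ℏ : ℂ) (e₁ : Fin p → Fin n) (e₂ : Fin q → Fin p)
    (γ : Fin q → ℂ) (β : Fin n → ℂ) (j : Fin n) (hj : ∀ a, e₁ a ≠ j) (x : ℂ) (hx : x ≠ β j)
    (t : Fin p → ℂ) :
    telescope ℏ e₁ e₂ γ β j x t - telescope ℏ e₁ e₂ γ β (j + 1) x t =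
      ℏ * ((x - β j)⁻¹ * ratioProd ℏ β j x) * crossProd ℏ e₁ j x t *
        upperProd ℏ (e₁ ∘ e₂) j γ x := by
  have hx' : x - β j ≠ 0 := sub_ne_zero.mpr hx
  have hj' : ∀ a, (e₁ a : ℕ) ≠ j := fun a h => hj a (Fin.ext h)
  rw [telescope, telescope, ratioProd_succ, crossProd_succ _ _ _ hj',
    upperProd_succ _ (e₁ ∘ e₂) _ fun c => hj' (e₂ c)]
  field_simp
  ring

/-- The contribution of an index not in the range of `e₁`. -/
lemma skewSum_insert {p q n : ℕ} (ℏ : ℂ) (E : Fin (p + 1) → Fin n) (hE : StrictMono E)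
    (s : Fin (p + 1)) (e₂ : Fin q → Fin p) (α : Fin (p + 1) → ℂ) (γ : Fin q → ℂ)
    (β : Fin n → ℂ) (hαβ : ∀ a j, α a ≠ β j) :
    ℏ * skewSum (fun t => gfun ℏ E t β * gfun ℏ (s.succAbove ∘ e₂) γ t) α =
      skewSum (fun t => gfun ℏ (E ∘ s.succAbove) (t ∘ Fin.succ) β * gfun ℏ e₂ γ (t ∘ Fin.succ) *
        (telescope ℏ (E ∘ s.succAbove) e₂ γ β (E s) (t 0) (t ∘ Fin.succ) -
          telescope ℏ (E ∘ s.succAbove) e₂ γ β (E s + 1) (t 0) (t ∘ Fin.succ))) α := by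
  rw [skewSum_comp _ s.cycleRange, skewSum, skewSum, Finset.mul_sum, Finset.mul_sum]
  refine Finset.sum_congr rfl fun σ _ => ?_
  have hs : ((α ∘ σ) ∘ s.cycleRange) s = (α ∘ σ) 0 := by simp
  have hsa : ((α ∘ σ) ∘ s.cycleRange) ∘ s.succAbove = (α ∘ σ) ∘ Fin.succ := by
    ext a; simp
  have hne : ∀ a, (E ∘ s.succAbove) a ≠ E s := fun a h => s.succAbove_ne a (hE.injective h)
  rw [telescope_sub_of_notMem ℏ (E ∘ s.succAbove) e₂ γ β (E s) hne ((α ∘ σ) 0) (hαβ _ _),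
    gfun_succAbove ℏ E hE s, gfun_comp_succAbove ℏ e₂ E hE s, hs, hsa,
    prod_neg_one_succAbove, Fin.sign_cycleRange]
  have hsq : ((-1 : ℂ) ^ (s : ℕ)) * (-1) ^ (s : ℕ) = 1 := by
    rw [← mul_pow]; simp
  push_cast
  simp only [Function.comp_assoc]
  linear_combination (ℏ * ((Equiv.Perm.sign σ : ℤ) : ℂ) *
    gfun ℏ (E ∘ s.succAbove) (α ∘ σ ∘ Fin.succ) β * gfun ℏ e₂ γ (α ∘ σ ∘ Fin.succ) *
    (((α ∘ σ) 0 - β (E s))⁻¹ * ratioProd ℏ β (E s) ((α ∘ σ) 0)) *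
    crossProd ℏ (E ∘ s.succAbove) (E s) ((α ∘ σ) 0) (α ∘ σ ∘ Fin.succ) *
    upperProd ℏ (E ∘ s.succAbove ∘ e₂) (E s) γ ((α ∘ σ) 0)) * hsq

lemma skewSum_eq_zero {p : ℕ} (F : (Fin p → ℂ) → ℂ) (ρ : Equiv.Perm (Fin p))
    (hρ : Equiv.Perm.sign ρ = -1) (α : Fin p → ℂ)
    (h : ∀ σ : Equiv.Perm (Fin p), F ((α ∘ σ) ∘ ρ) = F (α ∘ σ)) : skewSum F α = 0 := by
  have h1 := skewSum_comp F ρ α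
  have h2 : skewSum (fun t => F (t ∘ ρ)) α = skewSum F α :=
    Finset.sum_congr rfl fun σ _ => congrArg _ (h σ)
  rw [h2, hρ] at h1
  push_cast at h1
  linear_combination h1 / 2

/-- Dependence of `g` on a single variable of its second group. -/
lemma exists_gfun_eq_mul {p q : ℕ} (ℏ : ℂ) (e : Fin q → Fin (p + 1)) (s : Fin (p + 1))
    (γ : Fin q → ℂ) : ∃ W : (Fin p → ℂ) → ℂ, ∀ t : Fin (p + 1) → ℂ,
      gfun ℏ e γ t = W (t ∘ s.succAbove) *
        (∏ c, if s < e c then (γ c - t s - ℏ) / (γ c - t s) else 1) *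
        ∏ c, if e c = s then (γ c - t s)⁻¹ else 1 := by
  refine ⟨fun u => (∏ c, (if e c = s then 1 else
      (γ c - s.insertNth (α := fun _ => ℂ) 0 u (e c))⁻¹) *
    ∏ a, if s.succAbove a < e c then (γ c - u a - ℏ) / (γ c - u a) else 1) *
    ∏ a, ∏ b, if a < b then γ a - γ b - ℏ else 1, fun t => ?_⟩
  rw [gfun_eq, mul_assoc, mul_right_comm]
  congr 1
  rw [← Finset.prod_mul_distrib, ← Finset.prod_mul_distrib]
  refine Finset.prod_congr rfl fun c _ => ?_
  rw [ratioProd, Fin.prod_univ_succAbove _ s]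
  simp only [← Fin.lt_def, Function.comp]
  by_cases hc : e c = s
  · simp only [hc, if_true]
    ring
  · obtain ⟨a, ha⟩ := Fin.exists_succAbove_eq hc
    simp only [← ha, s.succAbove_ne a, if_false, Fin.insertNth_apply_succAbove, Function.comp]
    ring

lemma upperProd_comp {p q n : ℕ} (ℏ : ℂ) (e₁ : Fin p → Fin n) (h₁ : StrictMono e₁)
    (e₂ : Fin q → Fin p) (s : Fin p) (γ : Fin q → ℂ) (x : ℂ) :
    upperProd ℏ (e₁ ∘ e₂) (e₁ s) γ x =
      (∏ c, if s < e₂ c then (γ c - x - ℏ) / (γ c - x) else 1) *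
        ∏ c, if e₂ c = s then (γ c - x - ℏ) / (γ c - x) else 1 := by
  rw [upperProd, ← Finset.prod_mul_distrib]
  refine Finset.prod_congr rfl fun c _ => ?_
  simp only [Function.comp, ← Fin.lt_def, h₁.lt_iff_lt]
  rcases lt_trichotomy (e₂ c) s with h | h | h
  · simp [h, h.not_gt, h.ne]
  · simp [h]
  · simp [h, h.not_gt, h.ne']

lemma upperProd_comp_succ {p q n : ℕ} (ℏ : ℂ) (e₁ : Fin p → Fin n) (h₁ : StrictMono e₁)
    (e₂ : Fin q → Fin p) (s : Fin p) (γ : Fin q → ℂ) (x : ℂ) :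
    upperProd ℏ (e₁ ∘ e₂) (e₁ s + 1) γ x =
      ∏ c, if s < e₂ c then (γ c - x - ℏ) / (γ c - x) else 1 := by
  refine Finset.prod_congr rfl fun c _ => ?_
  simp only [Function.comp, Nat.lt_succ_iff, ← Fin.le_def, h₁.le_iff_le]
  rcases le_or_gt (e₂ c) s with h | h
  · simp [h, h.not_gt]
  · simp [h, h.not_ge]

lemma crossProd_succAbove {p n : ℕ} (ℏ : ℂ) (e : Fin (p + 1) → Fin n) (s : Fin (p + 1))
    (x : ℂ) (t : Fin (p + 1) → ℂ) :
    crossProd ℏ e (e s) x t =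
      (x - t s - ℏ) * crossProd ℏ (e ∘ s.succAbove) (e s) x (t ∘ s.succAbove) := by
  rw [crossProd, Fin.prod_univ_succAbove _ s]
  simp [crossProd]

lemma crossProd_succAbove_succ {p n : ℕ} (ℏ : ℂ) (e : Fin (p + 1) → Fin n) (he : StrictMono e)
    (s : Fin (p + 1)) (x : ℂ) (t : Fin (p + 1) → ℂ) :
    crossProd ℏ e (e s + 1) x t =
      (x - t s + ℏ) * crossProd ℏ (e ∘ s.succAbove) (e s) x (t ∘ s.succAbove) := by
  rw [← crossProd_succ _ (e ∘ s.succAbove), crossProd, Fin.prod_univ_succAbove _ s]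
  · simp [crossProd]
  · exact fun a h => s.succAbove_ne a (he.injective (Fin.ext h))

/-- The exchange identity for a single pair of variables. -/
lemma exchange {q : ℕ} (ℏ : ℂ) (P : Fin q → Prop) [DecidablePred P]
    (hP : ∀ c c', P c → P c' → c = c') (γ : Fin q → ℂ) (x y z : ℂ) (hx : x ≠ z) (hy : y ≠ z)
    (hγx : ∀ c, γ c ≠ x) (hγy : ∀ c, γ c ≠ y) :
    (∏ c, if P c then (γ c - y)⁻¹ else 1) * (y - z)⁻¹ *
        ((x - y - ℏ) * (∏ c, if P c then (γ c - x - ℏ) / (γ c - x) else 1) -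
          (x - z - ℏ) / (x - z) * (x - y + ℏ)) =
      (∏ c, if P c then (γ c - x)⁻¹ else 1) * (x - z)⁻¹ *
        ((y - x - ℏ) * (∏ c, if P c then (γ c - y - ℏ) / (γ c - y) else 1) -
          (y - z - ℏ) / (y - z) * (y - x + ℏ)) := by
  have hx' : x - z ≠ 0 := sub_ne_zero.mpr hx
  have hy' : y - z ≠ 0 := sub_ne_zero.mpr hy
  by_cases h : ∃ c, P c
  · obtain ⟨c₀, h₀⟩ := h
    have hiff : ∀ c, P c ↔ c = c₀ := fun c => ⟨fun h => hP _ _ h h₀, fun h => h ▸ h₀⟩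
    have hγx' : γ c₀ - x ≠ 0 := sub_ne_zero.mpr (hγx c₀)
    have hγy' : γ c₀ - y ≠ 0 := sub_ne_zero.mpr (hγy c₀)
    simp only [hiff, Finset.prod_ite_eq', Finset.mem_univ, if_true]
    field_simp
    ring
  · push Not at h
    simp only [h, if_false, Finset.prod_const_one]
    field_simp
    ring

/-- Symmetry of the contribution of an index `e₁ s` under exchanging two variables. -/
lemma telescope_exchange {p q n : ℕ} (ℏ : ℂ) (e₁ : Fin (p + 1) → Fin n) (h₁ : StrictMono e₁)
    (e₂ : Fin q → Fin (p + 1)) (h₂ : StrictMono e₂) (s : Fin (p + 1)) (γ : Fin q → ℂ)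
    (β : Fin n → ℂ) (x y : ℂ) (t t' : Fin (p + 1) → ℂ) (ht : t s = y) (ht' : t' s = x)
    (htt : t' ∘ s.succAbove = t ∘ s.succAbove) (hx : x ≠ β (e₁ s)) (hy : y ≠ β (e₁ s))
    (hγx : ∀ c, γ c ≠ x) (hγy : ∀ c, γ c ≠ y) :
    gfun ℏ e₁ t β * gfun ℏ e₂ γ t *
        (telescope ℏ e₁ e₂ γ β (e₁ s) x t - telescope ℏ e₁ e₂ γ β (e₁ s + 1) x t) =
      gfun ℏ e₁ t' β * gfun ℏ e₂ γ t' *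
        (telescope ℏ e₁ e₂ γ β (e₁ s) y t' - telescope ℏ e₁ e₂ γ β (e₁ s + 1) y t') := by
  obtain ⟨W, hW⟩ := exists_gfun_eq_mul ℏ e₂ s γ
  have key := exchange ℏ (fun c => e₂ c = s)
    (fun c c' h h' => h₂.injective (h.trans h'.symm)) γ x y _ hx hy hγx hγy
  simp only [telescope, hW, gfun_succAbove ℏ e₁ h₁ s, upperProd_comp ℏ e₁ h₁,
    upperProd_comp_succ ℏ e₁ h₁, crossProd_succAbove, crossProd_succAbove_succ ℏ e₁ h₁,
    ratioProd_succ, ht, ht', htt]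
  generalize W _ = W₀, gfun _ _ _ _ = G₀, (∏ a, if s.succAbove a < s then (-1 : ℂ) else 1) = S₀,
    crossProd _ _ _ x _ = X₁, crossProd _ _ _ y _ = X₂, ratioProd _ _ _ x = R₁,
    ratioProd _ _ _ y = R₂, (∏ c, if s < e₂ c then (γ c - x - ℏ) / (γ c - x) else 1) = U₁,
    (∏ c, if s < e₂ c then (γ c - y - ℏ) / (γ c - y) else 1) = U₂ at *
  linear_combination (W₀ * G₀ * S₀ * X₁ * X₂ * R₁ * R₂ * U₁ * U₂) * key

/-- The contribution of an index in the range of `e₁` vanishes. -/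
lemma skewSum_telescope_eq_zero {p q n : ℕ} (ℏ : ℂ) (e₁ : Fin p → Fin n)
    (h₁ : StrictMono e₁) (e₂ : Fin q → Fin p) (h₂ : StrictMono e₂) (s : Fin p)
    (α : Fin (p + 1) → ℂ) (γ : Fin q → ℂ) (β : Fin n → ℂ) (hαβ : ∀ a j, α a ≠ β j)
    (hγα : ∀ c a, γ c ≠ α a) :
    skewSum (fun t => gfun ℏ e₁ (t ∘ Fin.succ) β * gfun ℏ e₂ γ (t ∘ Fin.succ) *
        (telescope ℏ e₁ e₂ γ β (e₁ s) (t 0) (t ∘ Fin.succ) -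
          telescope ℏ e₁ e₂ γ β (e₁ s + 1) (t 0) (t ∘ Fin.succ))) α = 0 := by
  obtain _ | p := p
  · exact s.elim0
  refine skewSum_eq_zero _ (Equiv.swap 0 s.succ)
    (Equiv.Perm.sign_swap (Fin.succ_ne_zero s).symm) α fun σ => ?_
  refine telescope_exchange ℏ e₁ h₁ e₂ h₂ s γ β _ _ _ _ ?_ ?_ ?_
    (hαβ _ _) (hαβ _ _) (fun c => hγα c _) (fun c => hγα c _)
  · simp
  · simp
  · ext a
    simp only [Function.comp]
    rw [Equiv.swap_apply_of_ne_of_ne (Fin.succ_ne_zero _)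
      (fun h => s.succAbove_ne a (Fin.succ_injective _ h))]

lemma EnumOf.unique {k n : ℕ} {e e' : Fin k → Fin n} {S : Set (Fin n)} (he : EnumOf e S)
    (he' : EnumOf e' S) : e = e' :=
  (StrictMono.range_inj he.1 he'.1).mp <| by
    ext r
    have h₂ := he'.2 r
    exact (he.2 r).symm.trans h₂

/-- The enumerations after turning the zero entry `j` into `1`. -/
lemma exists_insert_enum {p q n : ℕ} (J : Fin n → Fin 3) (j : Fin n) (hj : (J j : ℕ) = 0)
    (E₁ : Fin (p + 1) → Fin n) (E₂ : Fin q → Fin (p + 1)) (e₁ : Fin p → Fin n)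
    (e₂ : Fin q → Fin p)
    (hE₁ : EnumOf E₁ {r | ((Function.update J j 1 : Fin n → Fin 3) r : ℕ) ≠ 0})
    (hE₂ : EnumOf E₂ {a | ((Function.update J j 1 : Fin n → Fin 3) (E₁ a) : ℕ) = 2})
    (he₁ : EnumOf e₁ {r | (J r : ℕ) ≠ 0}) (he₂ : EnumOf e₂ {a | (J (e₁ a) : ℕ) = 2}) :
    ∃ s, E₁ s = j ∧ E₁ ∘ s.succAbove = e₁ ∧ E₂ = s.succAbove ∘ e₂ := by
  obtain ⟨s, hs⟩ := (hE₁.2 j).mp (by simp)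
  have hsucc : E₁ ∘ s.succAbove = e₁ := by
    refine EnumOf.unique ⟨hE₁.1.comp s.strictMono_succAbove, fun r => ⟨fun hr => ?_, ?_⟩⟩ he₁
    · have hrj : r ≠ j := by rintro rfl; exact hr hj
      obtain ⟨b, hb⟩ := (hE₁.2 r).mp (by simpa [Function.update_of_ne hrj] using hr)
      obtain ⟨a, rfl⟩ := Fin.exists_succAbove_eq (x := b) (y := s)
        (by rintro rfl; exact hrj (hb.symm.trans hs))
      exact ⟨a, hb⟩
    · rintro ⟨a, rfl⟩
      have hne : E₁ (s.succAbove a) ≠ j := fun h =>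
        s.succAbove_ne a (hE₁.1.injective (h.trans hs.symm))
      have := (hE₁.2 (E₁ (s.succAbove a))).mpr ⟨_, rfl⟩
      simpa [Function.update_of_ne hne] using this
  have hne : ∀ a, E₁ (s.succAbove a) ≠ j := fun a h =>
    s.succAbove_ne a (hE₁.1.injective (h.trans hs.symm))
  refine ⟨s, hs, hsucc, hE₂.unique ⟨s.strictMono_succAbove.comp he₂.1, fun b => ⟨fun hb => ?_, ?_⟩⟩⟩
  · obtain ⟨a, rfl⟩ := Fin.exists_succAbove_eq (x := b) (y := s) (by
      rintro rfl
      simp [hs] at hb)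
    obtain ⟨c, hc⟩ := (he₂.2 a).mp (by
      rw [← hsucc]
      simpa [Function.update_of_ne (hne a)] using hb)
    exact ⟨c, by simp [hc]⟩
  · rintro ⟨c, rfl⟩
    have := (he₂.2 (e₂ c)).mpr ⟨c, rfl⟩
    rw [← hsucc] at this
    simpa [Function.update_of_ne (hne _)] using this

lemma telescope_zero {p q n : ℕ} (ℏ : ℂ) (e₁ : Fin p → Fin n) (e₂ : Fin q → Fin p)
    (γ : Fin q → ℂ) (β : Fin n → ℂ) (x : ℂ) (t : Fin p → ℂ) :
    telescope ℏ e₁ e₂ γ β 0 x t =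
      (∏ a, (x - t a - ℏ)) * ∏ c, (γ c - x - ℏ) / (γ c - x) := by
  simp [telescope, ratioProd, crossProd, upperProd]

lemma telescope_last {p q n : ℕ} (ℏ : ℂ) (e₁ : Fin p → Fin n) (e₂ : Fin q → Fin p)
    (γ : Fin q → ℂ) (β : Fin n → ℂ) (x : ℂ) (t : Fin p → ℂ) :
    telescope ℏ e₁ e₂ γ β n x t =
      (∏ i, (x - β i - ℏ) / (x - β i)) * ∏ a, (x - t a + ℏ) := by
  simp [telescope, ratioProd, crossProd, upperProd]

/-- The highest weight identity before skew-symmetrization over `γ`. -/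
lemma sum_skewSum_eq {p q n : ℕ} (ℏ : ℂ) (J : Fin n → Fin 3)
    (E₁ : Fin n → Fin (p + 1) → Fin n) (E₂ : Fin n → Fin q → Fin (p + 1))
    (hE : ∀ j, (J j : ℕ) = 0 →
      EnumOf (E₁ j) {r | ((Function.update J j 1 : Fin n → Fin 3) r : ℕ) ≠ 0} ∧
      EnumOf (E₂ j) {a | ((Function.update J j 1 : Fin n → Fin 3) (E₁ j a) : ℕ) = 2})
    (e₁ : Fin p → Fin n) (e₂ : Fin q → Fin p) (he₁ : EnumOf e₁ {r | (J r : ℕ) ≠ 0})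
    (he₂ : EnumOf e₂ {a | (J (e₁ a) : ℕ) = 2}) (α : Fin (p + 1) → ℂ) (γ : Fin q → ℂ)
    (β : Fin n → ℂ) (hαβ : ∀ a j, α a ≠ β j) (hγα : ∀ c a, γ c ≠ α a) :
    ℏ * ∑ j ∈ Finset.univ.filter fun j => (J j : ℕ) = 0,
        skewSum (fun t => gfun ℏ (E₁ j) t β * gfun ℏ (E₂ j) γ t) α =
      skewSum (fun t => gfun ℏ e₁ (t ∘ Fin.succ) β * gfun ℏ e₂ γ (t ∘ Fin.succ) *
        (telescope ℏ e₁ e₂ γ β 0 (t 0) (t ∘ Fin.succ) -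
          telescope ℏ e₁ e₂ γ β n (t 0) (t ∘ Fin.succ))) α := by
  have hsum : ∀ (x : ℂ) (t : Fin p → ℂ),
      telescope ℏ e₁ e₂ γ β 0 x t - telescope ℏ e₁ e₂ γ β n x t =
        ∑ j : Fin n, (telescope ℏ e₁ e₂ γ β j x t - telescope ℏ e₁ e₂ γ β (j + 1) x t) :=
    fun x t => by
      rw [Fin.sum_univ_eq_sum_range
        (fun j => telescope ℏ e₁ e₂ γ β j x t - telescope ℏ e₁ e₂ γ β (j + 1) x t) n,
        Finset.sum_range_sub']
  simp only [hsum, skewSum, Finset.mul_sum]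
  rw [Finset.sum_comm (s := Finset.univ (α := Equiv.Perm _)), Finset.sum_filter]
  refine Finset.sum_congr rfl fun j _ => ?_
  split_ifs with hj
  · obtain ⟨s, hs, hs₁, hs₂⟩ := exists_insert_enum J j hj (E₁ j) (E₂ j) e₁ e₂
      (hE j hj).1 (hE j hj).2 he₁ he₂
    have := skewSum_insert ℏ (E₁ j) (hE j hj).1.1 s e₂ α γ β hαβ
    rw [hs₁, hs, ← hs₂] at this
    simpa only [skewSum, Finset.mul_sum] using this
  · obtain ⟨s, rfl⟩ := (he₁.2 j).mp hj
    exact (skewSum_telescope_eq_zero ℏ e₁ he₁.1 e₂ he₂.1 s α γ β hαβ hγα).symm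

/-- Lemma `hw1` (the `sl₃` highest weight identity).  For
`J' ∈ Z_{ν₁−1,ν₂}` (an `n`-tuple with entries in `{0,1,2}`, `ν₁−1` nonzero entries
and `ν₂` entries equal to `2`), summing `w^{(3)}` over the tuples obtained from `J'`
by turning one zero entry into `1` gives the doubly skew-symmetrized right-hand side.
For each such modified tuple the corresponding sets `M₁`, `M₂` are given through their
increasing enumerations `E1 j`, `E2 j`, and `e1'`, `e2'` are those of `J'` itself.
The identity of rational functions is stated pointwise at all points where every
denominator occurring is nonzero. -/
theorem statement3 (ℏ : ℂ) (hℏ : ℏ ≠ 0) (n ν₁ ν₂ : ℕ)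
    (hν₁ : 1 ≤ ν₁) (hn : ν₁ ≤ n) (h21 : ν₂ ≤ ν₁)
    (J' : Fin n → Fin 3)
    (hJ'1 : (Finset.univ.filter fun r => (J' r : ℕ) ≠ 0).card = ν₁ - 1)
    (hJ'2 : (Finset.univ.filter fun r => (J' r : ℕ) = 2).card = ν₂)
    (E1 : Fin n → Fin ν₁ → Fin n) (E2 : Fin n → Fin ν₂ → Fin ν₁)
    (hE : ∀ j, (J' j : ℕ) = 0 →
      EnumOf (E1 j) {r | ((Function.update J' j 1 : Fin n → Fin 3) r : ℕ) ≠ 0} ∧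
      EnumOf (E2 j) {a | ((Function.update J' j 1 : Fin n → Fin 3) (E1 j a) : ℕ) = 2})
    (e1' : Fin (ν₁ - 1) → Fin n) (e2' : Fin ν₂ → Fin (ν₁ - 1))
    (he1' : EnumOf e1' {r | (J' r : ℕ) ≠ 0})
    (he2' : EnumOf e2' {a | (J' (e1' a) : ℕ) = 2})
    (α : Fin ν₁ → ℂ) (γ : Fin ν₂ → ℂ) (β : Fin n → ℂ)
    (hαβ : ∀ a j, α a ≠ β j) (hγα : ∀ m' a, γ m' ≠ α a) :
    ℏ * ∑ j ∈ Finset.univ.filter fun j => (J' j : ℕ) = 0, w3 ℏ (E1 j) (E2 j) α γ β =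
      ∑ τ : Equiv.Perm (Fin ν₂), ∑ σ : Equiv.Perm (Fin ν₁),
        ((Equiv.Perm.sign τ : ℤ) : ℂ) * ((Equiv.Perm.sign σ : ℤ) : ℂ) *
          (gfun ℏ e1' (fun a => (α ∘ σ) ⟨(a : ℕ) + 1, by have := a.isLt; omega⟩) β *
            gfun ℏ e2' (γ ∘ τ) (fun a => (α ∘ σ) ⟨(a : ℕ) + 1, by have := a.isLt; omega⟩) *
            ((∏ a ∈ Finset.univ.filter fun a : Fin ν₁ => 0 < (a : ℕ),
                ((α ∘ σ) ⟨0, hν₁⟩ - (α ∘ σ) a - ℏ)) *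
                (∏ m' : Fin ν₂,
                  ((γ ∘ τ) m' - (α ∘ σ) ⟨0, hν₁⟩ - ℏ) / ((γ ∘ τ) m' - (α ∘ σ) ⟨0, hν₁⟩)) -
              (∏ j : Fin n,
                  ((α ∘ σ) ⟨0, hν₁⟩ - β j - ℏ) / ((α ∘ σ) ⟨0, hν₁⟩ - β j)) *
                ∏ a ∈ Finset.univ.filter fun a : Fin ν₁ => 0 < (a : ℕ),
                  ((α ∘ σ) ⟨0, hν₁⟩ - (α ∘ σ) a + ℏ))) := by
  obtain ⟨p, rfl⟩ : ∃ p, ν₁ = p + 1 := ⟨ν₁ - 1, by omega⟩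
  have hprod : ∀ f : Fin (p + 1) → ℂ,
      ∏ a ∈ Finset.univ.filter (fun a : Fin (p + 1) => 0 < (a : ℕ)), f a =
        ∏ a : Fin p, f a.succ := fun f => by
    rw [Finset.prod_filter, Fin.prod_univ_succ]
    simp
  simp only [w3]
  rw [Finset.sum_comm, Finset.mul_sum]
  refine Finset.sum_congr rfl fun τ _ => ?_
  have key := sum_skewSum_eq (p := p) ℏ J' E1 E2 hE e1' e2' he1' he2' α (γ ∘ τ) β hαβ
    fun c a => hγα (τ c) a
  simp only [telescope_zero, telescope_last, skewSum] at key
  simp only [hprod, mul_assoc, ← Finset.mul_sum] at key ⊢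
  rw [mul_left_comm, key]
  rfl

end
end
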